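/- arXiv:2510.07250 — 4 statements merged into one kernel-verified Lean document; each statement's English description precedes it below -/
import Mathlib

section
/- Let σ > 0, let Θ ⊆ ℝ, and let v(y;θ) be a family of probability densities on ℝ satisfying Assumption 1. Suppose moreover that for every θ ∈ Θ and every y ∈ ℝ one has Σ_{k=0}^{∞} ∫_ℝ (σ^{2k}/(2k)!!)·|∂_x^{2k} v(y;x)|·u(x;θ) dx < ∞. Then the signed kernel S*(y|x) = Σ_{k=0}^{∞} ((−1)^k·σ^{2k}/(2k)!!)·∂_θ^{2k} v(y;θ)|_{θ=x} exactly deconvolves the Gaussian source: for every y ∈ ℝ and every θ ∈ Θ, ∫_ℝ S*(y|x)·u(x;θ) dx = v(y;θ). In particular the signed total-variation deficiency of S* from the Gaussian source to the target family is zero. -/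
open MeasureTheory Real Filter

/-- The Gaussian source density `u(x;θ)` with standard deviation `σ`. -/
noncomputable def srcDensity (σ θ x : ℝ) : ℝ :=
  (1 / (Real.sqrt (2 * Real.pi) * σ)) * Real.exp (-(x - θ)^2 / (2 * σ^2))

/-- Assumption 1: regularity of the target density `v(y;θ)` relative to the
parameter set `Θ` and the source standard deviation `σ`. -/
structure Assumption1 (σ : ℝ) (Θ : Set ℝ) (v : ℝ → ℝ → ℝ) : Prop where
  smooth : ∀ y : ℝ, ContDiff ℝ (⊤ : ℕ∞) (fun x => v y x)
  vanish_top : ∀ (k : ℕ) (y : ℝ), ∀ θ ∈ Θ,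
    Tendsto (fun x => iteratedDeriv k (fun t => v y t) x *
      Real.exp (-(x - θ)^2 / (2 * σ^2))) atTop (nhds 0)
  vanish_bot : ∀ (k : ℕ) (y : ℝ), ∀ θ ∈ Θ,
    Tendsto (fun x => iteratedDeriv k (fun t => v y t) x *
      Real.exp (-(x - θ)^2 / (2 * σ^2))) atBot (nhds 0)
  sq_integrable : ∀ (y : ℝ), ∀ θ ∈ Θ,
    Integrable (fun x => (v y (Real.sqrt 2 * σ * x + θ))^2 * Real.exp (-x^2))

/-- The optimal signed kernel
`S*(y|x) = Σ_{k=0}^∞ ((−1)^k σ^{2k}/(2k)!!) ∂_θ^{2k} v(y;θ)|_{θ=x}`,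
where `(2k)!! = 2^k k!`. -/
noncomputable def optSignedKernel (σ : ℝ) (v : ℝ → ℝ → ℝ) (y x : ℝ) : ℝ :=
  ∑' k : ℕ, ((-1 : ℝ)^k * σ^(2*k) / ((2:ℝ)^k * (Nat.factorial k : ℝ))) *
    iteratedDeriv (2*k) (fun θ => v y θ) x

/-- The derivative in the base point of a Taylor polynomial telescopes. -/
theorem hasDerivAt_taylorPolynomial_basePoint {a : ℕ → ℝ → ℝ} {s : ℝ}
    (ha : ∀ k, HasDerivAt (a k) (a (k + 1) s) s) (t : ℝ) (n : ℕ) :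
    HasDerivAt (fun τ => ∑ k ∈ Finset.range (n + 1), a k τ * (t - τ) ^ k / (k.factorial : ℝ))
      (a (n + 1) s * (t - s) ^ n / (n.factorial : ℝ)) s := by
  induction n with
  | zero => simpa using ha 0
  | succ n ih =>
    simp_rw [Finset.sum_range_succ _ (n + 1)]
    have hp : HasDerivAt (fun τ : ℝ => (t - τ) ^ (n + 1)) (-((n + 1 : ℝ) * (t - s) ^ n)) s := by
      refine (((hasDerivAt_id s).const_sub t).pow (n + 1)).congr_deriv ?_
      simp
    refine (ih.add (((ha (n + 1)).mul hp).div_const ((n + 1).factorial : ℝ))).congr_deriv ?_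
    rw [Nat.factorial_succ]
    push_cast
    field_simp
    ring

/-- Backward Taylor expansion under derivative bounds that blow up at most like `1 / √t`. -/
theorem hasSum_taylor_backward {a : ℕ → ℝ → ℝ} {L : ℝ} {A : ℕ → ℝ}
    (ha : ∀ k, ∀ t, 0 < t → t < L → HasDerivAt (a k) (a (k + 1) t) t)
    (hbd : ∀ k, ∀ t, 0 < t → t < L → |a k t| * √t ≤ A k)
    (hA : Summable fun k => A k * L ^ k / (k.factorial : ℝ))
    {t s : ℝ} (ht : 0 < t) (hts : t ≤ s) (hs : s < L) :
    HasSum (fun k => a k s * (t - s) ^ k / (k.factorial : ℝ)) (a 0 t) := by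
  have hL : 0 < L := by linarith
  have hst : 0 < √t := Real.sqrt_pos.2 ht
  have hAnn : ∀ k, 0 ≤ A k := fun k =>
    le_trans (mul_nonneg (abs_nonneg _) (Real.sqrt_nonneg t)) (hbd k t ht (by linarith))
  have hbd' : ∀ k, ∀ τ, t ≤ τ → τ < L → |a k τ| ≤ A k / √t := by
    intro k τ h1 h2
    rw [le_div_iff₀ hst]
    exact (mul_le_mul_of_nonneg_left (Real.sqrt_le_sqrt h1) (abs_nonneg _)).trans
      (hbd k τ (by linarith) h2)
  have hsum : Summable fun k => a k s * (t - s) ^ k / (k.factorial : ℝ) := by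
    refine Summable.of_norm_bounded (hA.mul_left (1 / √t)) fun k => ?_
    rw [Real.norm_eq_abs, abs_div, abs_mul, abs_pow, Nat.abs_cast]
    have h1 : |t - s| ^ k ≤ L ^ k := by
      gcongr
      rw [abs_le]; constructor <;> linarith
    calc |a k s| * |t - s| ^ k / (k.factorial : ℝ) ≤ (A k / √t) * L ^ k / (k.factorial : ℝ) := by
          gcongr
          · exact div_nonneg (hAnn k) hst.le
          · exact hbd' k s hts hs
      _ = _ := by ring
  refine (hsum.hasSum_iff_tendsto_nat).2 ?_
  rw [← tendsto_add_atTop_iff_nat 1, tendsto_iff_norm_sub_tendsto_zero]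
  set r := (s - t) / L with hr
  have hr0 : 0 ≤ r := div_nonneg (by linarith) hL.le
  have hr1 : r < 1 := by rw [hr, div_lt_one hL]; linarith
  have key : ∀ n : ℕ,
      ‖∑ k ∈ Finset.range (n + 1), a k s * (t - s) ^ k / (k.factorial : ℝ) - a 0 t‖
        ≤ (1 / √t) * (A (n + 1) * L ^ (n + 1) / ((n + 1).factorial : ℝ)) *
          (((n + 1 : ℕ) : ℝ) * r ^ (n + 1)) := by
    intro n
    have hmv := Convex.norm_image_sub_le_of_norm_hasDerivWithin_le (s := Set.Icc t s)
      (f := fun τ => ∑ k ∈ Finset.range (n + 1), a k τ * (t - τ) ^ k / (k.factorial : ℝ))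
      (f' := fun τ => a (n + 1) τ * (t - τ) ^ n / (n.factorial : ℝ))
      (C := A (n + 1) / √t * (s - t) ^ n / (n.factorial : ℝ)) (x := t) (y := s)
      (fun τ hτ => (hasDerivAt_taylorPolynomial_basePoint
        (fun k => ha k τ (by linarith [hτ.1]) (by linarith [hτ.2])) t n).hasDerivWithinAt)
      (fun τ hτ => by
        rw [Real.norm_eq_abs, abs_div, abs_mul, abs_pow, Nat.abs_cast]
        have h1 : |t - τ| ≤ s - t := by
          rw [abs_le]; constructor <;> linarith [hτ.1, hτ.2]
        gcongr
        · exact div_nonneg (hAnn _) hst.le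
        · exact hbd' _ τ hτ.1 (by linarith [hτ.2]))
      (convex_Icc t s) ⟨le_rfl, hts⟩ ⟨hts, le_rfl⟩
    have h0 : ∑ k ∈ Finset.range (n + 1), a k t * (t - t) ^ k / (k.factorial : ℝ) = a 0 t := by
      simp [Finset.sum_range_succ']
    rw [h0] at hmv
    refine hmv.trans (le_of_eq ?_)
    rw [Real.norm_eq_abs, abs_of_nonneg (by linarith : 0 ≤ s - t), Nat.factorial_succ, hr, div_pow]
    push_cast
    field_simp
    ring
  refine squeeze_zero (fun _ => norm_nonneg _) key ?_
  have h1 := ((hA.tendsto_atTop_zero.comp (tendsto_add_atTop_nat 1)).const_mul (1 / √t)).mul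
    ((tendsto_self_mul_const_pow_of_lt_one hr0 hr1).comp (tendsto_add_atTop_nat 1))
  simpa [Function.comp_def] using h1

/-- The Taylor series at the right endpoint `L`, evaluated at `0`, recovers the limit at `0`. -/
theorem tsum_taylor_endpoint {a : ℕ → ℝ → ℝ} {L ℓ : ℝ} {A α : ℕ → ℝ} (hL : 0 < L)
    (ha : ∀ k, ∀ t, 0 < t → t < L → HasDerivAt (a k) (a (k + 1) t) t)
    (hbd : ∀ k, ∀ t, 0 < t → t < L → |a k t| * √t ≤ A k)
    (hA : Summable fun k => A k * L ^ k / (k.factorial : ℝ))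
    (hα : ∀ k, Tendsto (a k) (nhdsWithin L (Set.Iio L)) (nhds (α k)))
    (hℓ : Tendsto (a 0) (nhdsWithin 0 (Set.Ioi 0)) (nhds ℓ)) :
    ∑' k, α k * (-L) ^ k / (k.factorial : ℝ) = ℓ := by
  have hmem : ∀ᶠ t in nhdsWithin (0 : ℝ) (Set.Ioi 0), 0 < t ∧ t < L / 2 :=
    Ioo_mem_nhdsGT (by linarith : (0 : ℝ) < L / 2)
  have hsub : Tendsto (fun t => L - t) (nhdsWithin (0 : ℝ) (Set.Ioi 0))
      (nhdsWithin L (Set.Iio L)) := by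
    refine tendsto_nhdsWithin_iff.2 ⟨?_, ?_⟩
    · have : Tendsto (fun t : ℝ => L - t) (nhds 0) (nhds (L - 0)) :=
        (continuous_const.sub continuous_id).tendsto 0
      rw [sub_zero] at this
      exact this.mono_left nhdsWithin_le_nhds
    · filter_upwards [hmem] with t ht
      simp [ht.1]
  have hlim : Tendsto
      (fun t => ∑' k, a k (L - t) * (t - (L - t)) ^ k / (k.factorial : ℝ))
      (nhdsWithin (0 : ℝ) (Set.Ioi 0)) (nhds (∑' k, α k * (-L) ^ k / (k.factorial : ℝ))) := by
    refine tendsto_tsum_of_dominated_convergence (hA.mul_left (1 / √(L / 2))) ?_ ?_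
    · intro k
      refine (((hα k).comp hsub).mul (Tendsto.pow ?_ k)).div_const _
      have : Tendsto (fun t : ℝ => t - (L - t)) (nhds 0) (nhds (0 - (L - 0))) :=
        (continuous_id.sub (continuous_const.sub continuous_id)).tendsto 0
      rw [sub_zero, zero_sub] at this
      exact this.mono_left nhdsWithin_le_nhds
    · filter_upwards [hmem] with t ht k
      have hpos : 0 < √(L / 2) := Real.sqrt_pos.2 (by linarith)
      rw [Real.norm_eq_abs, abs_div, abs_mul, abs_pow, Nat.abs_cast]
      have h1 : |t - (L - t)| ≤ L := by
        rw [abs_le]; constructor <;> linarith [ht.1, ht.2]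
      have h2 : |a k (L - t)| ≤ A k / √(L / 2) := by
        rw [le_div_iff₀ hpos]
        exact (mul_le_mul_of_nonneg_left
          (Real.sqrt_le_sqrt (by linarith [ht.2] : L / 2 ≤ L - t)) (abs_nonneg _)).trans
          (hbd k (L - t) (by linarith [ht.2]) (by linarith [ht.1]))
      calc |a k (L - t)| * |t - (L - t)| ^ k / (k.factorial : ℝ)
          ≤ A k / √(L / 2) * L ^ k / (k.factorial : ℝ) := by
            gcongr
            exact (abs_nonneg _).trans h2
        _ = _ := by ring
  refine tendsto_nhds_unique hlim (hℓ.congr' ?_)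
  filter_upwards [hmem] with t ht
  exact (hasSum_taylor_backward ha hbd hA ht.1 (by linarith [ht.2])
    (by linarith [ht.1])).tsum_eq.symm

/-- The mean of `F (θ + r Z)` for a standard Gaussian variable `Z`. -/
noncomputable def gaussMean (θ : ℝ) (F : ℝ → ℝ) (r : ℝ) : ℝ :=
  (√(2 * π))⁻¹ * ∫ z : ℝ, F (θ + r * z) * Real.exp (-z ^ 2 / 2)

/-- `F` is dominated by the reciprocal of the Gaussian centred at `θ` with variance `σ ^ 2`. -/
def GaussGrowth (σ θ : ℝ) (F : ℝ → ℝ) : Prop :=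
  ∃ C : ℝ, ∀ x, |F (θ + x)| ≤ C * Real.exp (x ^ 2 / (2 * σ ^ 2))

theorem gaussGrowth_of_tendsto {σ θ : ℝ} {F : ℝ → ℝ} (hF : Continuous F)
    (htop : Tendsto (fun x => F x * Real.exp (-(x - θ) ^ 2 / (2 * σ ^ 2))) atTop (nhds 0))
    (hbot : Tendsto (fun x => F x * Real.exp (-(x - θ) ^ 2 / (2 * σ ^ 2))) atBot (nhds 0)) :
    GaussGrowth σ θ F := by
  have hc : Continuous fun x => F x * Real.exp (-(x - θ) ^ 2 / (2 * σ ^ 2)) := by fun_prop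
  let f : ZeroAtInftyContinuousMap ℝ ℝ :=
    ⟨⟨_, hc⟩, by rw [cocompact_eq_atBot_atTop]; exact hbot.sup htop⟩
  refine ⟨‖f‖, fun x => ?_⟩
  have h := f.toBCF.norm_coe_le_norm (θ + x)
  have h' : |F (θ + x) * Real.exp (-(θ + x - θ) ^ 2 / (2 * σ ^ 2))| ≤ ‖f‖ := h
  rw [abs_mul, abs_of_pos (Real.exp_pos _), add_sub_cancel_left, neg_div, Real.exp_neg,
    ← div_eq_mul_inv, div_le_iff₀ (Real.exp_pos _)] at h'
  exact h'

theorem GaussGrowth.exists_bound {σ θ : ℝ} {F : ℝ → ℝ} (hσ : 0 < σ) (hF : GaussGrowth σ θ F)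
    {ρ : ℝ} (hρ : |ρ| < σ) :
    ∃ C : ℝ, ∃ b > 0, ∀ r z : ℝ, |r| ≤ |ρ| →
      |F (θ + r * z) * Real.exp (-z ^ 2 / 2)| ≤ C * Real.exp (-b * z ^ 2) := by
  obtain ⟨C, hC⟩ := hF
  have hC0 : 0 ≤ C := by simpa using (abs_nonneg _).trans (hC 0)
  have hlt : ρ ^ 2 < σ ^ 2 := sq_lt_sq.2 (by rwa [abs_of_pos hσ])
  refine ⟨C, (1 - ρ ^ 2 / σ ^ 2) / 2, ?_, fun r z hr => ?_⟩
  · have : ρ ^ 2 / σ ^ 2 < 1 := by rwa [div_lt_one (by positivity)]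
    linarith
  · rw [abs_mul, abs_of_pos (Real.exp_pos _)]
    refine (mul_le_mul_of_nonneg_right (hC (r * z)) (Real.exp_pos _).le).trans ?_
    rw [mul_assoc, ← Real.exp_add]
    have hr2 : r ^ 2 ≤ ρ ^ 2 := sq_le_sq.2 hr
    gcongr
    have : (r * z) ^ 2 / (2 * σ ^ 2) ≤ ρ ^ 2 * z ^ 2 / (2 * σ ^ 2) := by
      rw [mul_pow]; gcongr
    have h2 : -((1 - ρ ^ 2 / σ ^ 2) / 2) * z ^ 2 = ρ ^ 2 * z ^ 2 / (2 * σ ^ 2) + -z ^ 2 / 2 := by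
      field_simp; ring
    rw [h2]; linarith

theorem integrable_abs_mul_exp_neg_mul_sq {b : ℝ} (hb : 0 < b) :
    Integrable fun z : ℝ => |z| * Real.exp (-b * z ^ 2) := by
  refine (integrable_mul_exp_neg_mul_sq hb).norm.congr (ae_of_all _ fun z => ?_)
  simp

theorem GaussGrowth.integrable {σ θ : ℝ} {F : ℝ → ℝ} (hσ : 0 < σ) (hF : GaussGrowth σ θ F)
    (hc : Continuous F) {r : ℝ} (hr : |r| < σ) :
    Integrable fun z => F (θ + r * z) * Real.exp (-z ^ 2 / 2) := by
  obtain ⟨C, b, hb, h⟩ := hF.exists_bound hσ hr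
  exact ((integrable_exp_neg_mul_sq hb).const_mul C).mono'
    (by fun_prop) (ae_of_all _ fun z => h r z le_rfl)

theorem GaussGrowth.integrable_mul_id {σ θ : ℝ} {F : ℝ → ℝ} (hσ : 0 < σ)
    (hF : GaussGrowth σ θ F) (hc : Continuous F) {r : ℝ} (hr : |r| < σ) :
    Integrable fun z => F (θ + r * z) * z * Real.exp (-z ^ 2 / 2) := by
  obtain ⟨C, b, hb, h⟩ := hF.exists_bound hσ hr
  refine ((integrable_abs_mul_exp_neg_mul_sq hb).const_mul C).mono'
    (by fun_prop) (ae_of_all _ fun z => ?_)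
  have := mul_le_mul_of_nonneg_left (h r z le_rfl) (abs_nonneg z)
  rw [← abs_mul] at this
  rwa [Real.norm_eq_abs, mul_right_comm, mul_comm (F _ * _) z, mul_left_comm C]

theorem hasDerivAt_gauss_weight (z : ℝ) :
    HasDerivAt (fun z : ℝ => Real.exp (-z ^ 2 / 2)) (-z * Real.exp (-z ^ 2 / 2)) z := by
  have h : HasDerivAt (fun z : ℝ => -z ^ 2 / 2) (-z) z := by
    refine (((hasDerivAt_pow 2 z).neg).div_const 2).congr_deriv ?_
    norm_num
    ring
  exact h.exp.congr_deriv (mul_comm _ _)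

/-- Gaussian integration by parts. -/
theorem integral_mul_id_gauss {σ θ : ℝ} {F F' : ℝ → ℝ} (hσ : 0 < σ)
    (hF : GaussGrowth σ θ F) (hF' : GaussGrowth σ θ F') (hc' : Continuous F')
    (hd : ∀ x, HasDerivAt F (F' x) x) {r : ℝ} (hr : |r| < σ) :
    ∫ z, F (θ + r * z) * z * Real.exp (-z ^ 2 / 2) =
      r * ∫ z, F' (θ + r * z) * Real.exp (-z ^ 2 / 2) := by
  have hc : Continuous F := continuous_iff_continuousAt.2 fun x => (hd x).continuousAt
  have h1 := (hF'.integrable hσ hc' hr).const_mul r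
  have h2 := hF.integrable_mul_id hσ hc hr
  have hz := integral_eq_zero_of_hasDerivAt_of_integrable
    (f := fun z => F (θ + r * z) * Real.exp (-z ^ 2 / 2))
    (f' := fun z => r * (F' (θ + r * z) * Real.exp (-z ^ 2 / 2)) -
      F (θ + r * z) * z * Real.exp (-z ^ 2 / 2))
    (fun z => by
      have hl : HasDerivAt (fun z : ℝ => θ + r * z) r z := by
        simpa using ((hasDerivAt_id z).const_mul r).const_add θ
      refine (((hd (θ + r * z)).comp z hl).mul (hasDerivAt_gauss_weight z)).congr_deriv ?_
      simp only [Function.comp]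
      ring)
    (h1.sub h2) (hF.integrable hσ hc hr)
  rw [integral_sub h1 h2, integral_const_mul] at hz
  linarith

theorem hasDerivAt_gaussMean {σ θ : ℝ} {F F' F'' : ℝ → ℝ} (hσ : 0 < σ)
    (hF : GaussGrowth σ θ F) (hF' : GaussGrowth σ θ F') (hF'' : GaussGrowth σ θ F'')
    (hc'' : Continuous F'') (hd : ∀ x, HasDerivAt F (F' x) x)
    (hd' : ∀ x, HasDerivAt F' (F'' x) x) {r : ℝ} (hr : |r| < σ) :
    HasDerivAt (gaussMean θ F) (r * gaussMean θ F'' r) r := by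
  have hc : Continuous F := continuous_iff_continuousAt.2 fun x => (hd x).continuousAt
  have hc' : Continuous F' := continuous_iff_continuousAt.2 fun x => (hd' x).continuousAt
  obtain ⟨ρ, hrρ, hρ⟩ := exists_between hr
  have hρ0 : 0 < ρ := (abs_nonneg r).trans_lt hrρ
  obtain ⟨C, b, hb, h⟩ := hF'.exists_bound hσ (ρ := ρ) (by rwa [abs_of_pos hρ0])
  have hD := hasDerivAt_integral_of_dominated_loc_of_deriv_le (μ := volume) (𝕜 := ℝ)
    (F := fun r z => F (θ + r * z) * Real.exp (-z ^ 2 / 2))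
    (F' := fun r z => F' (θ + r * z) * z * Real.exp (-z ^ 2 / 2)) (x₀ := r)
    (bound := fun z => C * (|z| * Real.exp (-b * z ^ 2))) (s := Set.Ioo (-ρ) ρ)
    (Ioo_mem_nhds (abs_lt.1 hrρ).1 (abs_lt.1 hrρ).2)
    (Eventually.of_forall fun r => by fun_prop)
    (hF.integrable hσ hc hr) (by fun_prop)
    (ae_of_all _ fun z τ hτ => by
      have := mul_le_mul_of_nonneg_left
        (h τ z (by rw [abs_of_pos hρ0]; exact (abs_lt.2 hτ).le)) (abs_nonneg z)
      rw [← abs_mul] at this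
      rwa [Real.norm_eq_abs, mul_right_comm, mul_comm (F' _ * _) z, mul_left_comm C])
    ((integrable_abs_mul_exp_neg_mul_sq hb).const_mul C)
    (ae_of_all _ fun z τ _ => by
      have hl : HasDerivAt (fun τ : ℝ => θ + τ * z) z τ := by
        simpa using ((hasDerivAt_id τ).mul_const z).const_add θ
      exact ((hd (θ + τ * z)).comp τ hl).mul_const _)
  refine (hD.2.const_mul (√(2 * π))⁻¹).congr_deriv ?_
  rw [integral_mul_id_gauss hσ hF' hF'' hc'' hd' hr, gaussMean]
  ring

theorem hasDerivAt_gaussMean_sqrt {σ θ : ℝ} {F F' F'' : ℝ → ℝ} (hσ : 0 < σ)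
    (hF : GaussGrowth σ θ F) (hF' : GaussGrowth σ θ F') (hF'' : GaussGrowth σ θ F'')
    (hc'' : Continuous F'') (hd : ∀ x, HasDerivAt F (F' x) x)
    (hd' : ∀ x, HasDerivAt F' (F'' x) x) {t : ℝ} (ht : 0 < t) (hts : t < σ ^ 2) :
    HasDerivAt (fun t => gaussMean θ F (√t)) (1 / 2 * gaussMean θ F'' (√t)) t := by
  have hs : 0 < √t := Real.sqrt_pos.2 ht
  have hr : |√t| < σ := by
    rw [abs_of_pos hs]; exact (Real.sqrt_lt' hσ).2 hts
  refine ((hasDerivAt_gaussMean hσ hF hF' hF'' hc'' hd hd' hr).comp t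
    (Real.hasDerivAt_sqrt ht.ne')).congr_deriv ?_
  field_simp

theorem gaussMean_zero (θ : ℝ) (F : ℝ → ℝ) : gaussMean θ F 0 = F θ := by
  have h : ∫ z : ℝ, Real.exp (-z ^ 2 / 2) = √(2 * π) := by
    have := integral_gaussian (1 / 2)
    convert this using 2
    · ext z; ring_nf
    · ring_nf
  have hp : √(2 * π) ≠ 0 := (Real.sqrt_pos.2 (by positivity)).ne'
  simp only [gaussMean, zero_mul, add_zero, integral_const_mul, h]
  field_simp

theorem gaussMean_eq_integral_srcDensity {r : ℝ} (hr : 0 < r) (θ : ℝ) (F : ℝ → ℝ) :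
    gaussMean θ F r = ∫ x, F x * srcDensity r θ x := by
  have h1 : ∫ x, F x * srcDensity r θ x = ∫ x, F (θ + x) * srcDensity r θ (θ + x) :=
    (integral_add_left_eq_self (fun x => F x * srcDensity r θ x) θ).symm
  have h2 := Measure.integral_comp_mul_left (fun x => F (θ + x) * srcDensity r θ (θ + x)) r
  rw [abs_of_pos (inv_pos.2 hr), smul_eq_mul] at h2
  rw [h1, gaussMean, ← mul_inv_cancel_left₀ hr.ne' (∫ x, F (θ + x) * srcDensity r θ (θ + x)), ← h2,
    ← integral_const_mul, ← integral_const_mul]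
  refine integral_congr_ae (ae_of_all _ fun z => ?_)
  have h3 : -(θ + r * z - θ) ^ 2 / (2 * r ^ 2) = -z ^ 2 / 2 := by
    field_simp; ring
  simp only [srcDensity, h3]
  field_simp

theorem srcDensity_nonneg {σ : ℝ} (hσ : 0 ≤ σ) (θ x : ℝ) : 0 ≤ srcDensity σ θ x := by
  unfold srcDensity; positivity

theorem mul_srcDensity_le {r σ : ℝ} (hr : 0 < r) (hrσ : r ≤ σ) (θ x : ℝ) :
    r * srcDensity r θ x ≤ σ * srcDensity σ θ x := by
  have hσ : 0 < σ := hr.trans_le hrσ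
  have h : ∀ s : ℝ, 0 < s → s * srcDensity s θ x =
      (√(2 * π))⁻¹ * Real.exp (-((x - θ) ^ 2 / (2 * s ^ 2))) := by
    intro s hs
    simp only [srcDensity, neg_div]
    field_simp
  rw [h r hr, h σ hσ]
  gcongr

theorem continuous_srcDensity (σ θ : ℝ) : Continuous (srcDensity σ θ) := by
  unfold srcDensity; fun_prop

theorem abs_gaussMean_mul_le {r σ θ : ℝ} {F : ℝ → ℝ} (hr : 0 < r) (hrσ : r ≤ σ)
    (hF : Integrable fun x => F x * srcDensity σ θ x) :
    |gaussMean θ F r| * r ≤ σ * ∫ x, |F x| * srcDensity σ θ x := by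
  have hσ : 0 < σ := hr.trans_le hrσ
  have hF' : Integrable fun x => |F x| * srcDensity σ θ x := by
    refine hF.norm.congr (ae_of_all _ fun x => ?_)
    simp [abs_of_nonneg (srcDensity_nonneg hσ.le θ x)]
  rw [gaussMean_eq_integral_srcDensity hr, ← abs_of_pos hr, ← abs_mul, abs_of_pos hr,
    ← integral_mul_const, ← integral_const_mul, ← Real.norm_eq_abs]
  refine norm_integral_le_of_norm_le (hF'.const_mul σ) (ae_of_all _ fun x => ?_)
  rw [Real.norm_eq_abs, mul_assoc, abs_mul,
    abs_of_nonneg (mul_nonneg (srcDensity_nonneg hr.le θ x) hr.le)]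
  calc |F x| * (srcDensity r θ x * r) = |F x| * (r * srcDensity r θ x) := by ring
    _ ≤ |F x| * (σ * srcDensity σ θ x) := by
        exact mul_le_mul_of_nonneg_left (mul_srcDensity_le hr hrσ θ x) (abs_nonneg _)
    _ = _ := by ring

theorem tendsto_gaussMean_left {σ θ : ℝ} {F : ℝ → ℝ} (hσ : 0 < σ)
    (hc : Continuous F) (hF : Integrable fun x => F x * srcDensity σ θ x) :
    Tendsto (gaussMean θ F) (nhdsWithin σ (Set.Iio σ))
      (nhds (∫ x, F x * srcDensity σ θ x)) := by
  have hmem : ∀ᶠ r in nhdsWithin σ (Set.Iio σ), σ / 2 < r ∧ r < σ :=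
    Ioo_mem_nhdsLT (by linarith : σ / 2 < σ)
  have hlim : Tendsto (fun r => ∫ x, F x * srcDensity r θ x) (nhdsWithin σ (Set.Iio σ))
      (nhds (∫ x, F x * srcDensity σ θ x)) := by
    refine tendsto_integral_filter_of_dominated_convergence
      (fun x => 2 * ‖F x * srcDensity σ θ x‖) ?_ ?_ (hF.norm.const_mul 2) ?_
    · exact Eventually.of_forall fun r =>
        (hc.mul (continuous_srcDensity r θ)).aestronglyMeasurable
    · filter_upwards [hmem] with r hr
      refine ae_of_all _ fun x => ?_
      have hr0 : 0 < r := by linarith [hr.1]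
      have h1 := mul_srcDensity_le hr0 hr.2.le θ x
      have h0 := srcDensity_nonneg hσ.le θ x
      have h0' := srcDensity_nonneg hr0.le θ x
      have h2 : srcDensity r θ x ≤ 2 * srcDensity σ θ x := by
        have : σ / 2 * srcDensity r θ x ≤ r * srcDensity r θ x := by
          gcongr; exact hr.1.le
        nlinarith
      rw [norm_mul, norm_mul, Real.norm_of_nonneg h0, Real.norm_of_nonneg h0']
      calc ‖F x‖ * srcDensity r θ x ≤ ‖F x‖ * (2 * srcDensity σ θ x) := by gcongr
        _ = _ := by ring
    · refine ae_of_all _ fun x => Tendsto.const_mul _ ?_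
      have : ContinuousAt (fun r => srcDensity r θ x) σ := by
        unfold srcDensity
        refine ContinuousAt.mul (ContinuousAt.div continuousAt_const (by fun_prop) (by positivity))
          (Real.continuous_exp.continuousAt.comp
            (ContinuousAt.div continuousAt_const (by fun_prop) (by positivity)))
      exact this.tendsto.mono_left nhdsWithin_le_nhds
  refine hlim.congr' ?_
  filter_upwards [hmem] with r hr
  exact (gaussMean_eq_integral_srcDensity (by linarith [hr.1]) θ F).symm

/-- Inverse Gaussian smoothing: the alternating series of Gaussian means of even derivatives of `f`
recovers the value of `f` at the centre of the Gaussian. -/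
theorem tsum_integral_iteratedDeriv_srcDensity {σ θ : ℝ} {f : ℝ → ℝ} (hσ : 0 < σ)
    (hf : ContDiff ℝ (⊤ : ℕ∞) f) (hgrowth : ∀ k, GaussGrowth σ θ (iteratedDeriv k f))
    (hint : ∀ k, Integrable fun x => iteratedDeriv (2 * k) f x * srcDensity σ θ x)
    (hsum : Summable fun k : ℕ => σ ^ (2 * k) / ((2 : ℝ) ^ k * (k.factorial : ℝ)) *
      ∫ x, |iteratedDeriv (2 * k) f x| * srcDensity σ θ x) :
    ∑' k : ℕ, ((-1 : ℝ) ^ k * σ ^ (2 * k) / ((2 : ℝ) ^ k * (k.factorial : ℝ))) *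
      ∫ x, iteratedDeriv (2 * k) f x * srcDensity σ θ x = f θ := by
  have hcont : ∀ k, Continuous (iteratedDeriv k f) := fun k =>
    hf.continuous_iteratedDeriv k (by exact_mod_cast le_top)
  have hderiv : ∀ k x, HasDerivAt (iteratedDeriv k f) (iteratedDeriv (k + 1) f x) x := by
    intro k x
    rw [iteratedDeriv_succ]
    exact (hf.differentiable_iteratedDeriv k
      (by exact_mod_cast WithTop.coe_lt_top k)).differentiableAt.hasDerivAt
  have hsq : √(σ ^ 2) = σ := Real.sqrt_sq hσ.le
  have hsqrt_lt : ∀ t, t < σ ^ 2 → √t < σ := fun t ht => (Real.sqrt_lt' hσ).2 ht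
  have hmain := tsum_taylor_endpoint (L := σ ^ 2) (ℓ := f θ)
    (a := fun k t => (1 / 2) ^ k * gaussMean θ (iteratedDeriv (2 * k) f) (√t))
    (A := fun k => (1 / 2) ^ k * (σ * ∫ x, |iteratedDeriv (2 * k) f x| * srcDensity σ θ x))
    (α := fun k => (1 / 2) ^ k * ∫ x, iteratedDeriv (2 * k) f x * srcDensity σ θ x)
    (by positivity)
    (fun k t ht hts => by
      refine ((hasDerivAt_gaussMean_sqrt hσ (hgrowth (2 * k)) (hgrowth (2 * k + 1))
        (hgrowth (2 * k + 2)) (hcont _) (hderiv _) (hderiv _) ht hts).const_mul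
        ((1 / 2 : ℝ) ^ k)).congr_deriv ?_
      rw [pow_succ, mul_add]
      ring)
    (fun k t ht hts => by
      rw [abs_mul, abs_of_pos (by positivity : (0 : ℝ) < (1 / 2) ^ k), mul_assoc]
      exact mul_le_mul_of_nonneg_left (abs_gaussMean_mul_le (Real.sqrt_pos.2 ht)
        (hsqrt_lt t hts).le (hint k)) (by positivity))
    (by
      refine (hsum.mul_left σ).congr fun k => ?_
      rw [one_div, inv_pow, ← pow_mul]
      field_simp)
    (fun k => by
      refine Tendsto.const_mul _ ((tendsto_gaussMean_left hσ (hcont _) (hint k)).comp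
        (tendsto_nhdsWithin_iff.2 ⟨?_, ?_⟩))
      · have h := (Real.continuous_sqrt.tendsto (σ ^ 2))
        rw [hsq] at h
        exact h.mono_left nhdsWithin_le_nhds
      · filter_upwards [self_mem_nhdsWithin] with t ht using hsqrt_lt t ht)
    (by
      have h0 : ContinuousAt (gaussMean θ f) 0 :=
        (hasDerivAt_gaussMean (F' := iteratedDeriv 1 f) hσ (by simpa using hgrowth 0)
          (hgrowth 1) (hgrowth 2) (hcont 2) (by simpa using hderiv 0) (hderiv 1)
          (by simpa using hσ)).continuousAt
      have h1 : Tendsto (fun t => gaussMean θ f (√t)) (nhds 0) (nhds (f θ)) := by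
        rw [← gaussMean_zero θ f]
        refine h0.tendsto.comp ?_
        simpa using Real.continuous_sqrt.tendsto 0
      simpa using h1.mono_left nhdsWithin_le_nhds)
  rw [← hmain]
  refine tsum_congr fun k => ?_
  rw [one_div, inv_pow, neg_pow (σ ^ 2), ← pow_mul]
  field_simp

/-- Proposition 1: under Assumption 1 and the summability condition,
the optimal signed kernel exactly deconvolves the Gaussian source, and hence its
signed total-variation deficiency is zero. -/
theorem exact_deconvolution
    (σ : ℝ) (hσ : 0 < σ) (Θ : Set ℝ) (v : ℝ → ℝ → ℝ)
    (hA : Assumption1 σ Θ v)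
    (hv_nonneg : ∀ θ y : ℝ, 0 ≤ v y θ)
    (hv_int : ∀ θ : ℝ, Integrable (fun y => v y θ))
    (hv_one : ∀ θ : ℝ, ∫ y : ℝ, v y θ = 1)
    (hsum : ∀ θ ∈ Θ, ∀ y : ℝ,
      (∑' k : ℕ, ∫⁻ x : ℝ, ENNReal.ofReal
        ((σ^(2*k) / ((2:ℝ)^k * (Nat.factorial k : ℝ))) *
          |iteratedDeriv (2*k) (fun t => v y t) x| * srcDensity σ θ x)) < ⊤) :
    (∀ y : ℝ, ∀ θ ∈ Θ,
      ∫ x : ℝ, optSignedKernel σ v y x * srcDensity σ θ x = v y θ) ∧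
    (∀ θ ∈ Θ,
      (1/2) * ∫ y : ℝ,
        |(∫ x : ℝ, optSignedKernel σ v y x * srcDensity σ θ x) - v y θ| = 0) := by
  have hmain : ∀ y : ℝ, ∀ θ ∈ Θ,
      ∫ x : ℝ, optSignedKernel σ v y x * srcDensity σ θ x = v y θ := by
    intro y θ hθ
    set c : ℕ → ℝ := fun k => σ ^ (2 * k) / ((2 : ℝ) ^ k * (Nat.factorial k : ℝ)) with hc
    have hc0 : ∀ k, 0 < c k := fun k => by rw [hc]; positivity
    have hcont : ∀ k, Continuous (iteratedDeriv k fun t => v y t) := fun k =>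
      (hA.smooth y).continuous_iteratedDeriv k (by exact_mod_cast le_top)
    have hu : ∀ x, 0 ≤ srcDensity σ θ x := srcDensity_nonneg hσ.le θ
    have hlint := hsum θ hθ y
    have hnn : ∀ k x, 0 ≤ c k * |iteratedDeriv (2 * k) (fun t => v y t) x| * srcDensity σ θ x :=
      fun k x => mul_nonneg (mul_nonneg (hc0 k).le (abs_nonneg _)) (hu x)
    have hmeas : ∀ k, AEStronglyMeasurable
        (fun x => c k * |iteratedDeriv (2 * k) (fun t => v y t) x| * srcDensity σ θ x) volume :=
      fun k => ((continuous_const.mul (hcont _).abs).mul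
        (continuous_srcDensity σ θ)).aestronglyMeasurable
    have hlt : ∀ k, ∫⁻ x, ENNReal.ofReal
        (c k * |iteratedDeriv (2 * k) (fun t => v y t) x| * srcDensity σ θ x) ≠ ⊤ :=
      fun k => ENNReal.ne_top_of_tsum_ne_top hlint.ne k
    have hintabs : ∀ k, Integrable fun x =>
        c k * |iteratedDeriv (2 * k) (fun t => v y t) x| * srcDensity σ θ x := fun k =>
      (lintegral_ofReal_ne_top_iff_integrable (hmeas k) (ae_of_all _ (hnn k))).1 (hlt k)
    have hint : ∀ k, Integrable fun x =>
        iteratedDeriv (2 * k) (fun t => v y t) x * srcDensity σ θ x := fun k => by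
      refine ((hintabs k).const_mul (c k)⁻¹).mono'
        ((hcont _).mul (continuous_srcDensity σ θ)).aestronglyMeasurable
        (ae_of_all _ fun x => le_of_eq ?_)
      rw [norm_mul, Real.norm_eq_abs, Real.norm_of_nonneg (hu x), mul_assoc,
        inv_mul_cancel_left₀ (hc0 k).ne']
    have hsummable : Summable fun k =>
        c k * ∫ x, |iteratedDeriv (2 * k) (fun t => v y t) x| * srcDensity σ θ x := by
      refine (ENNReal.summable_toReal hlint.ne).congr fun k => ?_
      rw [← integral_eq_lintegral_of_nonneg_ae (ae_of_all _ (hnn k)) (hmeas k),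
        ← integral_const_mul]
      simp only [hc, mul_assoc]
    rw [← tsum_integral_iteratedDeriv_srcDensity hσ (hA.smooth y)
      (fun k => gaussGrowth_of_tendsto (hcont k) (hA.vanish_top k y θ hθ)
        (hA.vanish_bot k y θ hθ)) hint hsummable]
    have hswap := hasSum_integral_of_summable_integral_norm (μ := volume)
      (F := fun (k : ℕ) x => ((-1 : ℝ) ^ k * σ ^ (2 * k) / ((2 : ℝ) ^ k * (Nat.factorial k : ℝ))) *
        (iteratedDeriv (2 * k) (fun t => v y t) x * srcDensity σ θ x))
      (fun k => (hint k).const_mul _)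
      (by
        refine hsummable.congr fun k => ?_
        rw [← integral_const_mul]
        refine integral_congr_ae (ae_of_all _ fun x => ?_)
        have hk : |(-1 : ℝ) ^ k * σ ^ (2 * k) / ((2 : ℝ) ^ k * (Nat.factorial k : ℝ))| = c k := by
          rw [mul_div_assoc, abs_mul, abs_pow, abs_neg, abs_one, one_pow, one_mul]
          exact abs_of_pos (hc0 k)
        dsimp only
        rw [norm_mul, norm_mul, Real.norm_eq_abs, hk, Real.norm_eq_abs,
          Real.norm_of_nonneg (hu x)])
    simp only [integral_const_mul] at hswap
    rw [hswap.tsum_eq]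
    refine integral_congr_ae (ae_of_all _ fun x => ?_)
    simp only [optSignedKernel, ← tsum_mul_right, mul_assoc]
  refine ⟨hmain, fun θ hθ => ?_⟩
  simp [hmain _ θ hθ]
end

section
/- Let σ > 0, θ ∈ ℝ and y ∈ ℝ, and let x ↦ v(y;x) be infinitely differentiable with, for every integer j ≥ 0: (i) ∂_x^j v(y;x)·exp(−(x−θ)²/(2σ²)) → 0 as x → +∞ and as x → −∞, and (ii) x ↦ ∂_x^j v(y;x)·exp(−(x−θ)²/(2σ²)) integrable on ℝ. Then for every integer k ≥ 0, ∫_ℝ ∂_x^{2k} v(y;x)·u(x;θ) dx = (1/(√π·2^k·σ^{2k}))·∫_ℝ v(y; θ + √2·σ·x)·H_{2k}(x)·e^{−x²} dx. -/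
open MeasureTheory Real Filter

/-- The physicist's Hermite polynomial `H_n(x) = (−1)^n e^{x²} (d^n/dx^n) e^{−x²}`. -/
noncomputable def hermiteH (n : ℕ) (x : ℝ) : ℝ :=
  (-1 : ℝ)^n * Real.exp (x^2) * iteratedDeriv n (fun t => Real.exp (-t^2)) x

/-- A bound on a function and its derivative against the weight `(1 + x) ^ n * exp (-x ^ 2)`
on the half-line improves the weight for the function itself by one power of `1 + x`. -/
lemma integrableOn_Ioi_one_add_pow_succ_mul_exp_neg_sq {f f' : ℝ → ℝ} {n : ℕ}
    (hf : ∀ x, HasDerivAt f (f' x) x) (hf' : Continuous f')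
    (h1 : IntegrableOn (fun x => (1 + x) ^ n * Real.exp (-x ^ 2)) (Set.Ioi 0))
    (hi : IntegrableOn (fun x => f x * ((1 + x) ^ n * Real.exp (-x ^ 2))) (Set.Ioi 0))
    (hi' : IntegrableOn (fun x => f' x * ((1 + x) ^ n * Real.exp (-x ^ 2))) (Set.Ioi 0)) :
    IntegrableOn (fun x => f x * ((1 + x) ^ (n + 1) * Real.exp (-x ^ 2))) (Set.Ioi 0) := by
  have hfc : Continuous f := continuous_iff_continuousAt.2 fun x => (hf x).continuousAt
  set g : ℝ → ℝ := fun x => |f' x * ((1 + x) ^ n * Real.exp (-x ^ 2))| +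
    (n + 2) * ((1 + x) ^ n * Real.exp (-x ^ 2) +
      |f x * ((1 + x) ^ n * Real.exp (-x ^ 2))|) with hg
  have hgi : IntegrableOn g (Set.Ioi 0) := hi'.abs.add ((h1.add hi.abs).const_mul _)
  have hgc : Continuous g := by fun_prop
  set s : ℝ → ℝ := fun x => Real.sqrt (1 + f x ^ 2) with hs
  have hspos : ∀ x, 0 < s x := fun x => Real.sqrt_pos.2 (by positivity)
  have hsc : Continuous s := by fun_prop
  set b : ℝ → ℝ := fun x => -((f x * f' x / s x) * ((1 + x) ^ n * Real.exp (-x ^ 2)) +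
    s x * ((n * (1 + x) ^ (n - 1)) * Real.exp (-x ^ 2) +
      (1 + x) ^ n * (Real.exp (-x ^ 2) * (-(2 * x))))) with hb
  have hbc : Continuous b := by
    have : Continuous fun x => f x * f' x / s x :=
      (hfc.mul hf').div hsc fun x => (hspos x).ne'
    fun_prop
  have hB : ∀ x, HasDerivAt (fun x => -(s x * ((1 + x) ^ n * Real.exp (-x ^ 2)))) (b x) x := by
    intro x
    have e1 : HasDerivAt s (f x * f' x / s x) x := by
      have := (((hf x).fun_pow 2).const_add 1).sqrt (by positivity)
      convert this using 1
      simp only [hs]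
      field_simp
      simp only [Nat.cast_ofNat, Nat.add_one_sub_one, pow_one]
      ring
    have e2 : HasDerivAt (fun x : ℝ => (1 + x) ^ n) (n * (1 + x) ^ (n - 1)) x := by
      simpa using ((hasDerivAt_id x).const_add 1).fun_pow n
    have e3 : HasDerivAt (fun x : ℝ => Real.exp (-x ^ 2)) (Real.exp (-x ^ 2) * (-(2 * x))) x := by
      simpa using ((hasDerivAt_id x).fun_pow 2).fun_neg.exp
    exact (e1.fun_mul (e2.fun_mul e3)).fun_neg
  have key : ∀ x, 0 ≤ x → ‖f x * ((1 + x) ^ (n + 1) * Real.exp (-x ^ 2))‖ ≤ b x + g x := by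
    intro x hx
    have hfs : |f x| ≤ s x := Real.abs_le_sqrt (by linarith)
    have hs1 : s x ≤ 1 + |f x| := by
      rw [hs]
      refine Real.sqrt_le_iff.2 ⟨by positivity, ?_⟩
      nlinarith [abs_nonneg (f x), sq_abs (f x)]
    have hE := Real.exp_pos (-x ^ 2)
    simp only [hb, hg, Real.norm_eq_abs, abs_mul]
    rw [abs_of_pos hE, abs_of_nonneg (show 0 ≤ (1 + x) ^ n by positivity),
      abs_of_nonneg (show 0 ≤ (1 + x) ^ (n + 1) by positivity)]
    set E := Real.exp (-x ^ 2)
    have hQ : 0 < (1 + x) ^ n := by positivity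
    have hQ' : (1 + x) ^ (n - 1) ≤ (1 + x) ^ n :=
      pow_le_pow_right₀ (by linarith) (Nat.sub_le _ _)
    have a1 : f x * f' x / s x ≤ |f' x| := by
      rw [div_le_iff₀ (hspos x)]
      calc f x * f' x ≤ |f x * f' x| := le_abs_self _
        _ = |f' x| * |f x| := by rw [abs_mul, mul_comm]
        _ ≤ _ := by gcongr
    have a2 : (f x * f' x / s x) * ((1 + x) ^ n * E) ≤ |f' x| * ((1 + x) ^ n * E) := by gcongr
    have a3 : s x * (n * (1 + x) ^ (n - 1) * E) ≤ s x * (n * (1 + x) ^ n * E) := by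
      have := (hspos x).le
      gcongr
    have a4 : s x * ((n + 2) * (1 + x) ^ n * E) ≤ (1 + |f x|) * ((n + 2) * (1 + x) ^ n * E) := by
      gcongr
    have a5 : |f x| * ((1 + x) ^ (n + 1) * E) ≤ s x * ((1 + x) ^ (n + 1) * E) := by gcongr
    have a6 : 0 ≤ s x * ((1 + x) ^ (n + 1) * E) := by
      have := (hspos x).le
      positivity
    rw [pow_succ] at a5 a6 ⊢
    linear_combination a2 + a3 + a4 + a5 + a6
  have hFc : Continuous fun x => f x * ((1 + x) ^ (n + 1) * Real.exp (-x ^ 2)) := by fun_prop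
  refine integrableOn_Ioi_of_intervalIntegral_norm_bounded
    (s 0 + ∫ x in Set.Ioi (0 : ℝ), g x) 0 (l := atTop) (b := id)
    (fun R => (hFc.integrableOn_Icc).mono_set Set.Ioc_subset_Icc_self) tendsto_id ?_
  filter_upwards [eventually_ge_atTop 0] with R hR
  calc ∫ x in (0 : ℝ)..R, ‖f x * ((1 + x) ^ (n + 1) * Real.exp (-x ^ 2))‖
      ≤ ∫ x in (0 : ℝ)..R, (b x + g x) :=
        intervalIntegral.integral_mono_on hR (hFc.norm.intervalIntegrable _ _)
          ((hbc.add hgc).intervalIntegrable _ _) fun x hx => key x hx.1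
    _ = (-(s R * ((1 + R) ^ n * Real.exp (-R ^ 2))) -
          -(s 0 * ((1 + 0) ^ n * Real.exp (-0 ^ 2)))) + ∫ x in (0 : ℝ)..R, g x := by
        rw [intervalIntegral.integral_add (hbc.intervalIntegrable _ _)
          (hgc.intervalIntegrable _ _),
          intervalIntegral.integral_eq_sub_of_hasDerivAt (fun x _ => hB x)
            (hbc.intervalIntegrable _ _)]
    _ ≤ s 0 + ∫ x in Set.Ioi (0 : ℝ), g x := by
        have h2 : ∫ x in (0 : ℝ)..R, g x ≤ ∫ x in Set.Ioi (0 : ℝ), g x := by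
          rw [intervalIntegral.integral_of_le hR]
          refine setIntegral_mono_set hgi ?_ (Set.Ioc_subset_Ioi_self.eventuallyLE)
          filter_upwards [ae_restrict_mem measurableSet_Ioi] with x hx
          have : (0 : ℝ) < x := hx
          simp only [hg, Pi.zero_apply]
          positivity
        have h3 : 0 ≤ s R * ((1 + R) ^ n * Real.exp (-R ^ 2)) := by
          have := (hspos R).le
          positivity
        simp only [add_zero, one_pow, ne_eq, OfNat.ofNat_ne_zero, not_false_eq_true, zero_pow,
          neg_zero, Real.exp_zero, mul_one, sub_neg_eq_add]
        linarith

lemma integrableOn_Ioi_one_add_pow_mul_exp_neg_sq (n : ℕ) :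
    IntegrableOn (fun x : ℝ => (1 + x) ^ n * Real.exp (-x ^ 2)) (Set.Ioi 0) := by
  induction n with
  | zero => simpa using (integrable_exp_neg_mul_sq one_pos).integrableOn
  | succ n ih =>
    simpa using integrableOn_Ioi_one_add_pow_succ_mul_exp_neg_sq (f := fun _ => 1)
      (f' := fun _ => 0) (fun x => hasDerivAt_const x 1) continuous_const ih
      (by simpa using ih) (by simp)

/-- If all members of a sequence of successive derivatives are integrable against `exp (-x ^ 2)`
on the half-line, they remain so after multiplication by a power of `x`. -/
lemma integrableOn_Ioi_mul_pow_mul_exp_neg_sq {F : ℕ → ℝ → ℝ}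
    (hF : ∀ j x, HasDerivAt (F j) (F (j + 1) x) x)
    (hi : ∀ j, IntegrableOn (fun x => F j x * Real.exp (-x ^ 2)) (Set.Ioi 0)) (n j : ℕ) :
    IntegrableOn (fun x => F j x * (x ^ n * Real.exp (-x ^ 2))) (Set.Ioi 0) := by
  have hFc : ∀ j, Continuous (F j) := fun j =>
    continuous_iff_continuousAt.2 fun x => (hF j x).continuousAt
  have h : IntegrableOn (fun x => F j x * ((1 + x) ^ n * Real.exp (-x ^ 2))) (Set.Ioi 0) := by
    induction n generalizing j with
    | zero => simpa using hi j
    | succ n ih =>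
      exact integrableOn_Ioi_one_add_pow_succ_mul_exp_neg_sq (hF j) (hFc _)
        (integrableOn_Ioi_one_add_pow_mul_exp_neg_sq n) (ih j) (ih (j + 1))
  have hc := hFc j
  have hc' : Continuous fun x => F j x * (x ^ n * Real.exp (-x ^ 2)) := by fun_prop
  refine Integrable.mono h hc'.aestronglyMeasurable ?_
  filter_upwards [ae_restrict_mem measurableSet_Ioi] with x hx
  have hx : (0 : ℝ) < x := hx
  simp only [norm_mul, norm_pow, Real.norm_eq_abs, abs_of_pos hx,
    abs_of_pos (show (0 : ℝ) < 1 + x by linarith)]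
  gcongr
  linarith

lemma integrable_mul_pow_mul_exp_neg_sq {F : ℕ → ℝ → ℝ}
    (hF : ∀ j x, HasDerivAt (F j) (F (j + 1) x) x)
    (hi : ∀ j, Integrable fun x => F j x * Real.exp (-x ^ 2)) (n j : ℕ) :
    Integrable fun x => F j x * (x ^ n * Real.exp (-x ^ 2)) := by
  have hpos := integrableOn_Ioi_mul_pow_mul_exp_neg_sq hF (fun j => (hi j).integrableOn) n j
  have hneg := integrableOn_Ioi_mul_pow_mul_exp_neg_sq
    (F := fun j x => (-1) ^ j * F j (-x))
    (fun j x => by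
      refine (((hF j (-x)).comp x (hasDerivAt_neg x)).const_mul ((-1) ^ j)).congr_deriv ?_
      ring)
    (fun j => by
      have := ((hi j).comp_neg.const_mul ((-1) ^ j)).integrableOn (s := Set.Ioi 0)
      simpa [mul_assoc] using this) n j
  have hneg' : IntegrableOn (fun x => F j x * (x ^ n * Real.exp (-x ^ 2))) (Set.Iio 0) := by
    have := (IntegrableOn.integrable_indicator (hneg.const_mul ((-1) ^ (n + j)))
      measurableSet_Ioi).comp_neg
    rw [← integrable_indicator_iff measurableSet_Iio]
    refine this.congr (ae_of_all _ fun x => ?_)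
    beta_reduce
    by_cases hx : x < 0
    · rw [Set.indicator_of_mem (Set.mem_Iio.2 hx),
        Set.indicator_of_mem (Set.mem_Ioi.2 (neg_pos.2 hx))]
      have h1 : ((-1 : ℝ) ^ n) ^ 2 = 1 := by rw [← pow_mul, mul_comm, pow_mul]; simp
      have h2 : ((-1 : ℝ) ^ j) ^ 2 = 1 := by rw [← pow_mul, mul_comm, pow_mul]; simp
      rw [neg_neg, neg_sq, neg_pow x n, pow_add]
      linear_combination (F j x * x ^ n * Real.exp (-x ^ 2)) * (((-1) ^ j) ^ 2 * h1 + h2)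
    · rw [Set.indicator_of_notMem (by simpa using hx),
        Set.indicator_of_notMem (by simpa using hx)]
  rw [← integrableOn_univ, ← Set.Iic_union_Ioi (a := (0 : ℝ))]
  exact ((integrableOn_Iic_iff_integrableOn_Iio).2 hneg').union hpos

lemma contDiff_exp_neg_sq : ContDiff ℝ (⊤ : ℕ∞) fun t : ℝ => Real.exp (-t ^ 2) := by
  fun_prop

lemma hasDerivAt_iteratedDeriv {f : ℝ → ℝ} (hf : ContDiff ℝ (⊤ : ℕ∞) f) (n : ℕ) (x : ℝ) :
    HasDerivAt (iteratedDeriv n f) (iteratedDeriv (n + 1) f x) x := by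
  rw [iteratedDeriv_succ]
  exact ((hf.differentiable_iteratedDeriv n (by exact_mod_cast ENat.natCast_lt_top n)) x).hasDerivAt

lemma exists_polynomial_iteratedDeriv_exp_neg_sq (n : ℕ) :
    ∃ p : Polynomial ℝ, ∀ x : ℝ,
      iteratedDeriv n (fun t : ℝ => Real.exp (-t ^ 2)) x = p.eval x * Real.exp (-x ^ 2) := by
  induction n with
  | zero => exact ⟨1, by simp⟩
  | succ n ih =>
    obtain ⟨p, hp⟩ := ih
    refine ⟨p.derivative - 2 * Polynomial.X * p, fun x => ?_⟩
    have e3 : HasDerivAt (fun x : ℝ => Real.exp (-x ^ 2)) (Real.exp (-x ^ 2) * (-(2 * x))) x := by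
      simpa using ((hasDerivAt_id x).fun_pow 2).fun_neg.exp
    rw [iteratedDeriv_succ, funext hp, ((p.hasDerivAt x).fun_mul e3).deriv]
    simp
    ring

lemma integrable_mul_iteratedDeriv_exp_neg_sq {F : ℕ → ℝ → ℝ}
    (hF : ∀ j x, HasDerivAt (F j) (F (j + 1) x) x)
    (hi : ∀ j, Integrable fun x => F j x * Real.exp (-x ^ 2)) (n j : ℕ) :
    Integrable fun x => F j x * iteratedDeriv n (fun t : ℝ => Real.exp (-t ^ 2)) x := by
  obtain ⟨p, hp⟩ := exists_polynomial_iteratedDeriv_exp_neg_sq n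
  simp only [hp, Polynomial.eval_eq_sum_range, Finset.sum_mul, Finset.mul_sum]
  refine integrable_finsetSum _ fun i _ => ?_
  refine ((integrable_mul_pow_mul_exp_neg_sq hF hi i j).const_mul (p.coeff i)).congr
    (ae_of_all _ fun x => ?_)
  dsimp only
  ring

lemma integral_mul_iteratedDeriv_exp_neg_sq {F : ℕ → ℝ → ℝ}
    (hF : ∀ j x, HasDerivAt (F j) (F (j + 1) x) x)
    (hi : ∀ j, Integrable fun x => F j x * Real.exp (-x ^ 2)) (n j : ℕ) :
    ∫ x, F j x * iteratedDeriv n (fun t : ℝ => Real.exp (-t ^ 2)) x =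
      (-1) ^ n * ∫ x, F (j + n) x * Real.exp (-x ^ 2) := by
  induction n generalizing j with
  | zero => simp
  | succ n ih =>
    have h := integrable_mul_iteratedDeriv_exp_neg_sq hF hi
    rw [integral_mul_deriv_eq_deriv_mul_of_integrable (fun x _ => hF j x)
      (fun x _ => hasDerivAt_iteratedDeriv contDiff_exp_neg_sq n x) (h (n + 1) j) (h n (j + 1)) (h n j),
      ih, show j + 1 + n = j + (n + 1) by ring]
    ring

/-- integration by parts identity expressing the Gaussian-smoothed
even derivatives of the target density via Hermite coefficients. -/
theorem gaussian_smoothed_derivative_hermite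
    (σ θ y : ℝ) (hσ : 0 < σ) (v : ℝ → ℝ → ℝ)
    (hsmooth : ContDiff ℝ (⊤ : ℕ∞) (fun x => v y x))
    (hvanish_top : ∀ j : ℕ,
      Tendsto (fun x => iteratedDeriv j (fun t => v y t) x *
        Real.exp (-(x - θ)^2 / (2 * σ^2))) atTop (nhds 0))
    (hvanish_bot : ∀ j : ℕ,
      Tendsto (fun x => iteratedDeriv j (fun t => v y t) x *
        Real.exp (-(x - θ)^2 / (2 * σ^2))) atBot (nhds 0))
    (hint : ∀ j : ℕ,
      Integrable (fun x => iteratedDeriv j (fun t => v y t) x *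
        Real.exp (-(x - θ)^2 / (2 * σ^2)))) :
    ∀ k : ℕ,
      ∫ x : ℝ, iteratedDeriv (2*k) (fun t => v y t) x * srcDensity σ θ x
        = (1 / (Real.sqrt Real.pi * (2:ℝ)^k * σ^(2*k))) *
            ∫ x : ℝ, v y (θ + Real.sqrt 2 * σ * x) * hermiteH (2*k) x * Real.exp (-x^2) := by
  intro k
  set c : ℝ := Real.sqrt 2 * σ with hc
  have hc0 : 0 < c := by positivity
  set F : ℕ → ℝ → ℝ := fun j t => c ^ j * iteratedDeriv j (fun t => v y t) (θ + c * t) with hFdef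
  have hF : ∀ j x, HasDerivAt (F j) (F (j + 1) x) x := by
    intro j x
    have h1 : HasDerivAt (fun t : ℝ => θ + c * t) c x := by
      simpa using ((hasDerivAt_id x).const_mul c).const_add θ
    refine (((hasDerivAt_iteratedDeriv hsmooth j (θ + c * x)).comp x h1).const_mul
      (c ^ j)).congr_deriv ?_
    ring
  have hexp : ∀ t, Real.exp (-(θ + c * t - θ) ^ 2 / (2 * σ ^ 2)) = Real.exp (-t ^ 2) := by
    intro t
    congr 1
    rw [hc]
    field_simp
    rw [add_sub_cancel_left, mul_pow, mul_pow, Real.sq_sqrt (by norm_num)]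
    ring
  have hi : ∀ j, Integrable fun x => F j x * Real.exp (-x ^ 2) := by
    intro j
    have := (((hint j).comp_add_left θ).comp_mul_left' hc0.ne').const_mul (c ^ j)
    simpa only [hexp, ← mul_assoc] using this
  have hsub : ∀ g : ℝ → ℝ, ∫ x, g x = c * ∫ t, g (θ + c * t) := by
    intro g
    rw [Measure.integral_comp_mul_left (fun t => g (θ + t)), integral_add_left_eq_self g,
      abs_of_pos (inv_pos.2 hc0), smul_eq_mul, mul_inv_cancel_left₀ hc0.ne']
  have hR : ∀ x, v y (θ + c * x) * hermiteH (2 * k) x * Real.exp (-x ^ 2) =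
      F 0 x * iteratedDeriv (2 * k) (fun t : ℝ => Real.exp (-t ^ 2)) x := by
    intro x
    have : Real.exp (x ^ 2) * Real.exp (-x ^ 2) = 1 := by rw [← Real.exp_add]; simp
    simp only [hFdef, hermiteH, pow_mul, neg_one_sq, one_pow, pow_zero, iteratedDeriv_zero]
    linear_combination (v y (θ + c * x) *
      iteratedDeriv (2 * k) (fun t : ℝ => Real.exp (-t ^ 2)) x) * this
  have hL : ∀ t, iteratedDeriv (2 * k) (fun t => v y t) (θ + c * t) *
      srcDensity σ θ (θ + c * t) =
      (1 / (Real.sqrt (2 * Real.pi) * σ) / c ^ (2 * k)) * (F (2 * k) t * Real.exp (-t ^ 2)) := by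
    intro t
    simp only [srcDensity, hexp, hFdef]
    field_simp
  have hcpow : c ^ (2 * k) = 2 ^ k * σ ^ (2 * k) := by
    rw [hc, mul_pow, pow_mul (Real.sqrt 2), Real.sq_sqrt (by norm_num)]
  rw [hsub, integral_congr_ae (ae_of_all _ hL), integral_congr_ae (ae_of_all _ hR),
    integral_const_mul, integral_mul_iteratedDeriv_exp_neg_sq hF hi, zero_add, hcpow,
    pow_mul (-1 : ℝ), neg_one_sq, one_pow, one_mul, ← mul_assoc]
  congr 1
  rw [hc, Real.sqrt_mul (by norm_num)]
  field_simp
end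

section
/- Let σ > 0, Θ ⊆ ℝ, let v(y;θ) be a family of probability densities satisfying Assumption 1, let N ∈ ℕ, and let S*_N, p, q, T*_N be as defined. Fix θ ∈ Θ and assume that (x,y) ↦ |S*_N(y|x)|·u(x;θ) is integrable on ℝ² and that 0 < p(x) < ∞ for every x ∈ ℝ. Then (1/2)·∫_ℝ |∫_ℝ T*_N(y|x)·u(x;θ) dx − v(y;θ)| dy ≤ (1/2)·∫_ℝ |∫_ℝ S*_N(y|x)·u(x;θ) dx − v(y;θ)| dy + (1/2)·∫_ℝ (|p(x) − 1| + q(x))·u(x;θ) dx. -/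
open MeasureTheory Real Filter

/-- The truncated signed kernel
`S*_N(y|x) = Σ_{k=0}^N ((−1)^k σ^{2k}/(2k)!!) ∂_θ^{2k} v(y;θ)|_{θ=x}`,
with `(2k)!! = 2^k k!`. -/
noncomputable def signedKernel (σ : ℝ) (v : ℝ → ℝ → ℝ) (N : ℕ) (y x : ℝ) : ℝ :=
  ∑ k ∈ Finset.range (N + 1),
    ((-1 : ℝ)^k * σ^(2*k) / ((2:ℝ)^k * (Nat.factorial k : ℝ))) *
      iteratedDeriv (2*k) (fun θ => v y θ) x

/-- `p(x) = ∫ max(S*_N(y|x), 0) dy`. -/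
noncomputable def pFun (σ : ℝ) (v : ℝ → ℝ → ℝ) (N : ℕ) (x : ℝ) : ℝ :=
  ∫ y : ℝ, max (signedKernel σ v N y x) 0

/-- `q(x) = −∫ min(S*_N(y|x), 0) dy`. -/
noncomputable def qFun (σ : ℝ) (v : ℝ → ℝ → ℝ) (N : ℕ) (x : ℝ) : ℝ :=
  - ∫ y : ℝ, min (signedKernel σ v N y x) 0

/-- The Markov kernel `T*_N(y|x) = max(S*_N(y|x), 0) / p(x)`. -/
noncomputable def markovKernel (σ : ℝ) (v : ℝ → ℝ → ℝ) (N : ℕ) (y x : ℝ) : ℝ :=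
  max (signedKernel σ v N y x) 0 / pFun σ v N x

/-- A Carathéodory function, continuous in one variable and almost everywhere measurable in the
other, is almost everywhere measurable on the product. -/
theorem aestronglyMeasurable_prod_of_continuous {Y : Type*} [MeasurableSpace Y] {μ : Measure ℝ}
    {ν : Measure Y} [SFinite μ] [SFinite ν] {f : Y → ℝ → ℝ} (hc : ∀ y, Continuous (f y))
    (hm : ∀ x, AEStronglyMeasurable (fun y => f y x) ν) :
    AEStronglyMeasurable (fun z : ℝ × Y => f z.2 z.1) (μ.prod ν) := by
  classical
  have hae : ∀ᵐ y ∂ν, ∀ q : ℚ, f y q = (hm q).mk _ y :=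
    ae_all_iff.2 fun q => (hm q).ae_eq_mk
  obtain ⟨E, hEsub, hE, hE0⟩ := exists_measurable_superset_of_null (ae_iff.1 hae)
  have hgood : ∀ y ∉ E, ∀ q : ℚ, f y q = (hm q).mk _ y := by
    intro y hy
    by_contra hcon
    exact hy (hEsub hcon)
  have hmeas : ∀ x, StronglyMeasurable (fun y => if y ∈ E then 0 else f y x) := by
    intro x
    obtain ⟨r, -, -, hr⟩ := Real.exists_seq_rat_strictMono_tendsto x
    refine stronglyMeasurable_of_tendsto (u := atTop)
      (f := fun n y => if y ∈ E then 0 else (hm (r n)).mk _ y) (fun n => ?_) ?_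
    · exact StronglyMeasurable.ite hE stronglyMeasurable_const (hm (r n)).stronglyMeasurable_mk
    · refine tendsto_pi_nhds.2 fun y => ?_
      by_cases hy : y ∈ E
      · simp [hy]
      · simp only [hy, if_false, ← hgood y hy]
        exact ((hc y).tendsto x).comp hr
  have hjoint : StronglyMeasurable
      (Function.uncurry fun (x : ℝ) (y : Y) => if y ∈ E then 0 else f y x) := by
    refine stronglyMeasurable_uncurry_of_continuous_of_stronglyMeasurable (fun y => ?_) hmeas
    by_cases hy : y ∈ E
    · simpa [hy] using continuous_const
    · simpa [hy] using hc y
  refine ⟨_, hjoint, ?_⟩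
  have hEae : ∀ᵐ y ∂ν, y ∉ E := measure_eq_zero_iff_ae_notMem.1 hE0
  filter_upwards [Measure.quasiMeasurePreserving_snd.ae hEae] with z hz
  simp [Function.uncurry, hz]

theorem aestronglyMeasurable_iteratedDeriv_param {Y : Type*} [MeasurableSpace Y] {ν : Measure Y}
    {f : Y → ℝ → ℝ} (hc : ∀ y, ContDiff ℝ (⊤ : ℕ∞) (f y))
    (hm : ∀ x, AEStronglyMeasurable (fun y => f y x) ν) (k : ℕ) (x : ℝ) :
    AEStronglyMeasurable (fun y => iteratedDeriv k (f y) x) ν := by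
  induction k generalizing x with
  | zero => simpa using hm x
  | succ k ih =>
    refine aestronglyMeasurable_of_tendsto_ae (u := atTop)
      (f := fun (n : ℕ) y => (1 / ((n : ℝ) + 1))⁻¹ *
        (iteratedDeriv k (f y) (x + 1 / ((n : ℝ) + 1)) - iteratedDeriv k (f y) x))
      (fun n => ((ih _).sub (ih _)).const_mul _) (ae_of_all _ fun y => ?_)
    have hd : HasDerivAt (iteratedDeriv k (f y)) (iteratedDeriv (k + 1) (f y) x) x := by
      rw [iteratedDeriv_succ]
      exact ((hc y).differentiable_iteratedDeriv k
        (by exact_mod_cast WithTop.coe_lt_top k) x).hasDerivAt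
    refine hd.tendsto_slope_zero_right.comp (tendsto_nhdsWithin_iff.2
      ⟨tendsto_one_div_add_atTop_nhds_zero_nat, Eventually.of_forall fun n => ?_⟩)
    exact Set.mem_Ioi.2 (by positivity)

/-- Replacing a signed kernel by its normalized positive part costs at most the normalization
discrepancy plus the mass of the negative part. -/
theorem integral_abs_normalized_posPart_sub_le {X Y : Type*} [MeasurableSpace X]
    [MeasurableSpace Y] {μ : Measure X} {ν : Measure Y} [SFinite μ] [SFinite ν]
    {S : Y → X → ℝ} {u : X → ℝ} {w : Y → ℝ} (hu : Integrable u μ) (hu0 : ∀ x, 0 < u x)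
    (hw : Integrable w ν)
    (hS : AEStronglyMeasurable (fun z : X × Y => S z.2 z.1) (μ.prod ν))
    (hint : Integrable (fun z : X × Y => |S z.2 z.1| * u z.1) (μ.prod ν))
    (hp : ∀ x, 0 < ∫ y, max (S y x) 0 ∂ν) :
    ∫ y, |(∫ x, max (S y x) 0 / (∫ t, max (S t x) 0 ∂ν) * u x ∂μ) - w y| ∂ν
      ≤ (∫ y, |(∫ x, S y x * u x ∂μ) - w y| ∂ν)
        + ∫ x, (|(∫ y, max (S y x) 0 ∂ν) - 1| + -∫ y, min (S y x) 0 ∂ν) * u x ∂μ := by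
  set p : X → ℝ := fun x => ∫ y, max (S y x) 0 ∂ν with hpdef
  have hum : AEStronglyMeasurable (fun z : X × Y => u z.1) (μ.prod ν) :=
    hu.aestronglyMeasurable.comp_fst
  have hSu : Integrable (fun z : X × Y => S z.2 z.1 * u z.1) (μ.prod ν) :=
    hint.mono (hS.mul hum) (ae_of_all _ fun z => by simp)
  have hPu : Integrable (fun z : X × Y => max (S z.2 z.1) 0 * u z.1) (μ.prod ν) := by
    refine hint.mono ((hS.sup aestronglyMeasurable_const).mul hum) (ae_of_all _ fun z => ?_)
    simp only [norm_mul, Real.norm_eq_abs, abs_abs]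
    refine mul_le_mul_of_nonneg_right ?_ (abs_nonneg _)
    rw [abs_of_nonneg (le_max_right (S z.2 z.1) 0)]
    exact max_le (le_abs_self _) (abs_nonneg _)
  have hslice : ∀ᵐ x ∂μ, Integrable (fun y => S y x) ν := by
    filter_upwards [hSu.prod_right_ae] with x hx
    simpa [mul_assoc, (hu0 x).ne'] using hx.mul_const (u x)⁻¹
  have hpu : Integrable (fun x => p x * u x) μ := by
    simpa only [integral_mul_const] using hPu.integral_prod_left
  have hpm : AEStronglyMeasurable p μ := by
    refine (hpu.aestronglyMeasurable.div₀
      hu.aestronglyMeasurable).congr (ae_of_all _ fun x => ?_)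
    exact mul_div_cancel_right₀ _ (hu0 x).ne'
  have hTu : Integrable (fun z : X × Y => max (S z.2 z.1) 0 / p z.1 * u z.1) (μ.prod ν) := by
    have hm : AEStronglyMeasurable (fun z : X × Y => max (S z.2 z.1) 0 / p z.1 * u z.1)
        (μ.prod ν) :=
      ((hS.sup aestronglyMeasurable_const).div₀ hpm.comp_fst).mul hum
    refine (integrable_prod_iff hm).2 ⟨?_, ?_⟩
    · filter_upwards [hslice] with x hx
      exact (hx.pos_part.div_const _).mul_const _
    · refine hu.congr (ae_of_all _ fun x => ?_)
      have hx : ∀ y, ‖max (S y x) 0 / p x * u x‖ = max (S y x) 0 / p x * u x := fun y =>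
        Real.norm_of_nonneg (mul_nonneg (div_nonneg (le_max_right _ _) (hp x).le) (hu0 x).le)
      simp only [hx, integral_mul_const, integral_div]
      rw [div_self (hp x).ne', one_mul]
  have hD : Integrable (fun z : X × Y => |max (S z.2 z.1) 0 / p z.1 - S z.2 z.1| * u z.1)
      (μ.prod ν) := by
    refine (hTu.sub hSu).abs.congr (ae_of_all _ fun z => ?_)
    simp only [Pi.sub_apply]
    rw [← sub_mul, abs_mul, abs_of_pos (hu0 _)]
  have hpointwise : ∀ᵐ y ∂ν, |(∫ x, max (S y x) 0 / p x * u x ∂μ) - w y| ≤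
      |(∫ x, S y x * u x ∂μ) - w y| + ∫ x, |max (S y x) 0 / p x - S y x| * u x ∂μ := by
    filter_upwards [hTu.prod_left_ae, hSu.prod_left_ae] with y hT hSy
    have hdiff : |(∫ x, max (S y x) 0 / p x * u x ∂μ) - ∫ x, S y x * u x ∂μ| ≤
        ∫ x, |max (S y x) 0 / p x - S y x| * u x ∂μ := by
      rw [← integral_sub hT hSy]
      refine (abs_integral_le_integral_abs).trans_eq (integral_congr_ae (ae_of_all _ fun x => ?_))
      simp only
      rw [← sub_mul, abs_mul, abs_of_pos (hu0 _)]
    have := abs_sub_le (∫ x, max (S y x) 0 / p x * u x ∂μ) (∫ x, S y x * u x ∂μ) (w y)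
    linarith
  have hqu : Integrable (fun x => (-∫ y, min (S y x) 0 ∂ν) * u x) μ := by
    have hsub : Integrable (fun x => p x * u x - ∫ y, S y x * u x ∂ν) μ :=
      hpu.sub hSu.integral_prod_left
    refine hsub.congr ?_
    filter_upwards [hslice] with x hx
    rw [integral_mul_const, ← sub_mul, hpdef, ← integral_sub hx.pos_part hx, ← integral_neg]
    congr 2 with y
    linarith [max_add_min (S y x) 0]
  have hR : Integrable (fun x => (|p x - 1| + -∫ y, min (S y x) 0 ∂ν) * u x) μ := by
    refine ((hpu.sub hu).abs.add hqu).congr (ae_of_all _ fun x => ?_)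
    simp only [Pi.add_apply, Pi.sub_apply]
    rw [← sub_one_mul, abs_mul, abs_of_pos (hu0 x), add_mul]
  have hslice_le : ∀ᵐ x ∂μ, ∫ y, |max (S y x) 0 / p x - S y x| * u x ∂ν ≤
      (|p x - 1| + -∫ y, min (S y x) 0 ∂ν) * u x := by
    filter_upwards [hslice] with x hx
    rw [integral_mul_const]
    refine mul_le_mul_of_nonneg_right ?_ (hu0 x).le
    have hpx : 0 < p x := hp x
    have hmin : Integrable (fun y => -min (S y x) 0) ν := (hx.inf (integrable_zero _ _ _)).neg
    have hscale : p x * |1 / p x - 1| = |p x - 1| := by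
      rw [← abs_of_pos hpx, ← abs_mul, abs_of_pos hpx, mul_sub,
        mul_one_div_cancel hpx.ne', abs_sub_comm, mul_one]
    rw [← hscale, ← integral_mul_const, ← integral_neg,
      ← integral_add (hx.pos_part.mul_const _) hmin]
    refine integral_mono ((hx.pos_part.div_const _).sub hx).abs
      ((hx.pos_part.mul_const _).add hmin) fun y => ?_
    have hsplit : max (S y x) 0 / p x - S y x =
        max (S y x) 0 * (1 / p x - 1) + -min (S y x) 0 := by
      have := max_add_min (S y x) 0
      rw [mul_sub, mul_one_div]
      linarith
    simp only
    rw [hsplit]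
    refine (abs_add_le _ _).trans_eq ?_
    rw [abs_mul, abs_of_nonneg (le_max_right (S y x) 0),
      abs_of_nonneg (neg_nonneg.2 (min_le_right (S y x) 0))]
  have hSw : Integrable (fun y => |(∫ x, S y x * u x ∂μ) - w y|) ν :=
    (hSu.integral_prod_right.sub hw).abs
  have hDy : Integrable (fun y => ∫ x, |max (S y x) 0 / p x - S y x| * u x ∂μ) ν :=
    hD.integral_prod_right
  calc
    _ ≤ ∫ y, (|(∫ x, S y x * u x ∂μ) - w y| +
          ∫ x, |max (S y x) 0 / p x - S y x| * u x ∂μ) ∂ν :=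
      integral_mono_ae (hTu.integral_prod_right.sub hw).abs
        (hSw.add hDy) hpointwise
    _ = (∫ y, |(∫ x, S y x * u x ∂μ) - w y| ∂ν) +
          ∫ x, ∫ y, |max (S y x) 0 / p x - S y x| * u x ∂ν ∂μ := by
      rw [integral_add hSw hDy,
        integral_integral_swap (f := fun x y => |max (S y x) 0 / p x - S y x| * u x) hD]
    _ ≤ _ :=
      add_le_add le_rfl (integral_mono_ae hD.integral_prod_left hR hslice_le)

theorem srcDensity_pos {σ : ℝ} (hσ : 0 < σ) (θ x : ℝ) : 0 < srcDensity σ θ x := by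
  unfold srcDensity
  positivity

theorem integrable_srcDensity {σ : ℝ} (hσ : 0 < σ) (θ : ℝ) : Integrable (srcDensity σ θ) := by
  have hb : 0 < 1 / (2 * σ ^ 2) := by positivity
  refine (((integrable_exp_neg_mul_sq hb).comp_sub_right θ).const_mul
    (1 / (Real.sqrt (2 * Real.pi) * σ))).congr (ae_of_all _ fun x => ?_)
  simp only [srcDensity]
  congr 2
  ring

theorem aestronglyMeasurable_signedKernel {v : ℝ → ℝ → ℝ}
    (hc : ∀ y, ContDiff ℝ (⊤ : ℕ∞) (v y))
    (hm : ∀ x, AEStronglyMeasurable (fun y => v y x)) (σ : ℝ) (N : ℕ) :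
    AEStronglyMeasurable (fun z : ℝ × ℝ => signedKernel σ v N z.2 z.1) := by
  refine aestronglyMeasurable_prod_of_continuous (f := signedKernel σ v N)
    (fun y => ?_) (fun x => ?_)
  · exact continuous_finsetSum _ fun k _ => continuous_const.mul
      ((hc y).continuous_iteratedDeriv (2 * k) (WithTop.coe_le_coe.2 (le_top : ((2 * k : ℕ) : ℕ∞) ≤ ⊤)))
  · exact Finset.aestronglyMeasurable_fun_sum _ fun k _ =>
      (aestronglyMeasurable_iteratedDeriv_param hc hm (2 * k) x).const_mul _

/-- the Markov-kernel deficiency is bounded by the signed-kernel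
deficiency plus the normalization discrepancy. -/
theorem markov_deficiency_triangle
    (σ : ℝ) (hσ : 0 < σ) (Θ : Set ℝ) (v : ℝ → ℝ → ℝ)
    (hA : Assumption1 σ Θ v)
    (hv_nonneg : ∀ θ y : ℝ, 0 ≤ v y θ)
    (hv_int : ∀ θ : ℝ, Integrable (fun y => v y θ))
    (hv_one : ∀ θ : ℝ, ∫ y : ℝ, v y θ = 1)
    (N : ℕ) (θ : ℝ) (hθ : θ ∈ Θ)
    (hint : Integrable (fun z : ℝ × ℝ => |signedKernel σ v N z.2 z.1| * srcDensity σ θ z.1))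
    (hp : ∀ x : ℝ, Integrable (fun y => max (signedKernel σ v N y x) 0) ∧ 0 < pFun σ v N x) :
    (1/2) * ∫ y : ℝ,
        |(∫ x : ℝ, markovKernel σ v N y x * srcDensity σ θ x) - v y θ|
      ≤ (1/2) * (∫ y : ℝ,
          |(∫ x : ℝ, signedKernel σ v N y x * srcDensity σ θ x) - v y θ|)
        + (1/2) * ∫ x : ℝ, (|pFun σ v N x - 1| + qFun σ v N x) * srcDensity σ θ x := by
  have h := integral_abs_normalized_posPart_sub_le (integrable_srcDensity hσ θ)
    (srcDensity_pos hσ θ) (hv_int θ)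
    (aestronglyMeasurable_signedKernel hA.smooth (fun x => (hv_int x).aestronglyMeasurable) σ N)
    hint (fun x => (hp x).2)
  rw [← mul_add]
  exact mul_le_mul_of_nonneg_left h (by norm_num)
end

section
/- Consider the Gaussian source with variance σ² and the location target with scale τ and negative log-density ψ (parameter set Θ = ℝ). Suppose ψ satisfies Assumption 2 with constants (C_ψ, C̃_ψ), and suppose the parameters N ∈ ℕ, τ, λ, σ satisfy 2N+1 ≥ C̄_ψ, τ ≥ 8e·σ·max{C̃_ψ, λ·N}, σ > 0 and λ > 0. Then for every θ ∈ ℝ, (1/2)·∫_ℝ |∫_ℝ T*_N(y|x)·u(x;θ) dx − v(y;θ)| dy ≤ C̄_ψ·exp(−(2e)^{−1}·(2N+1)^{1/(2(1+C_ψ))}) + 4·Err(ψ, 2N, λ). -/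
open MeasureTheory Real Filter

/-- The location target density `v(y;θ) = (1/τ)·exp(−ψ((y−θ)/τ))`. -/
noncomputable def locDensity (ψ : ℝ → ℝ) (τ y θ : ℝ) : ℝ :=
  (1/τ) * Real.exp (-ψ ((y - θ)/τ))

/-- The weighted derivative sum `Σ_{j=1}^{n} |ψ^{(j)}(t)|/(λ^j·j!)`. -/
noncomputable def derivSum (ψ : ℝ → ℝ) (n : ℕ) (lam t : ℝ) : ℝ :=
  ∑ j ∈ Finset.Icc 1 n, |iteratedDeriv j ψ t| / (lam^j * (Nat.factorial j : ℝ))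

/-- The set `A(ψ,n,λ) = {t : Σ_{j=1}^{n} |ψ^{(j)}(t)|/(λ^j·j!) ≤ 1}`. -/
def ASet (ψ : ℝ → ℝ) (n : ℕ) (lam : ℝ) : Set ℝ :=
  {t : ℝ | derivSum ψ n lam t ≤ 1}

/-- `Err(ψ,n,λ)`. -/
noncomputable def ErrPsi (ψ : ℝ → ℝ) (n : ℕ) (lam : ℝ) : ℝ :=
  (∫ t in (ASet ψ n lam)ᶜ, Real.exp (-ψ t)) +
    ⨆ k ∈ Finset.Icc 1 n,
      ∫ t in (ASet ψ n lam)ᶜ, Real.exp (-ψ t) * (derivSum ψ n lam t)^k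

/-- `M(ψ,n,λ)`. -/
noncomputable def MPsi (ψ : ℝ → ℝ) (n : ℕ) (lam : ℝ) : ℝ :=
  ⨆ k ∈ Finset.Icc 1 n, ⨆ t : ℝ,
    Real.exp (-ψ t + ψ (t/2)) * (1 + (derivSum ψ n lam t)^k)

/-- Assumption 2 on the negative log-density `ψ` with constants `(Cψ, C̃ψ)`. -/
structure Assumption2 (ψ : ℝ → ℝ) (Cψ : ℕ) (Ct : ℝ) : Prop where
  Ct_pos : 0 < Ct
  norm_one : ∫ t : ℝ, Real.exp (-ψ t) = 1
  sq_int : Integrable (fun t : ℝ => Real.exp (-(2 * ψ t)))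
  smooth : ContDiff ℝ (⊤ : ℕ∞) ψ
  moment_int : ∀ n : ℕ, 1 ≤ n → ∀ k : ℕ, 1 ≤ k → k ≤ n →
    Integrable (fun t : ℝ => Real.exp (-ψ t) * (derivSum ψ n Ct t)^k)
  moment_le : ∀ n : ℕ, 1 ≤ n → ∀ k : ℕ, 1 ≤ k → k ≤ n →
    ∫ t : ℝ, Real.exp (-ψ t) * (derivSum ψ n Ct t)^k ≤ (Nat.factorial (Cψ * n) : ℝ)

/-- `C̄ψ = 16π²·(2e)^{4(1+Cψ)}·e^{4(1+Cψ)²}`. -/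
noncomputable def CbarPsi (Cψ : ℕ) : ℝ :=
  16 * Real.pi^2 * (2 * Real.exp 1)^(4*(1+Cψ)) * (Real.exp 1)^(4*(1+Cψ)^2)

open ProbabilityTheory Polynomial in
lemma integrable_eval_gaussianReal (P : Polynomial ℝ) :
    Integrable (fun z => P.eval z) (gaussianReal 0 1) := by
  induction P using Polynomial.induction_on' with
  | add p q hp hq => exact (hp.add hq).congr (ae_of_all _ fun z => by simp)
  | monomial n a =>
    simp only [Polynomial.eval_monomial]
    refine Integrable.const_mul ?_ a
    refine (memLp_one_iff_integrable).1 ?_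
    have h := (memLp_id_gaussianReal (μ := 0) (v := 1) (n : NNReal))
    rcases Nat.eq_zero_or_pos n with rfl | hn
    · simpa using (memLp_const (1:ℝ))
    · have := h.integrable_norm_pow (p := n) (by omega)
      refine memLp_one_iff_integrable.2 (this.mono' (by fun_prop) (ae_of_all _ fun x => ?_))
      simp

open ProbabilityTheory in
/-- Stein's identity for the standard Gaussian. -/
lemma integral_id_mul_gaussianReal {G G' : ℝ → ℝ} (hG : ∀ x, HasDerivAt G (G' x) x)
    (h0 : Integrable G (gaussianReal 0 1)) (h1 : Integrable (fun z => z * G z) (gaussianReal 0 1))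
    (h2 : Integrable G' (gaussianReal 0 1)) :
    ∫ z, z * G z ∂(gaussianReal 0 1) = ∫ z, G' z ∂(gaussianReal 0 1) := by
  have key : ∀ F : ℝ → ℝ, Integrable F (gaussianReal 0 1) →
      Integrable (fun z => gaussianPDFReal 0 1 z * F z) := by
    intro F hF
    rw [gaussianReal_of_var_ne_zero 0 one_ne_zero,
      integrable_withDensity_iff_integrable_smul' (measurable_gaussianPDF 0 1)
        (ae_of_all _ fun _ => gaussianPDF_lt_top)] at hF
    simpa [toReal_gaussianPDF] using hF
  have hφ : ∀ x, HasDerivAt (gaussianPDFReal 0 1) (-x * gaussianPDFReal 0 1 x) x := by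
    intro x
    have : HasDerivAt (fun y : ℝ => (√(2 * π * (1 : NNReal)))⁻¹ *
        Real.exp (-(y - 0) ^ 2 / (2 * (1 : NNReal))))
        ((√(2 * π * (1 : NNReal)))⁻¹ * (Real.exp (-(x - 0) ^ 2 / (2 * (1 : NNReal))) * (-x))) x := by
      refine (HasDerivAt.exp ?_).const_mul _
      have := ((((hasDerivAt_id x).sub_const 0).pow 2).neg).div_const (2 * ((1 : NNReal) : ℝ))
      convert! this using 1
      simp
      ring
    convert! this using 1
    simp [gaussianPDFReal]
    ring
  have hz := integral_eq_zero_of_hasDerivAt_of_integrable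
    (f := fun z => gaussianPDFReal 0 1 z * G z)
    (f' := fun z => gaussianPDFReal 0 1 z * G' z - gaussianPDFReal 0 1 z * (z * G z))
    (fun x => by
      convert! (hφ x).mul (hG x) using 1
      ring)
    ((key _ h2).sub (key _ h1)) (key _ h0)
  rw [integral_sub (key _ h2) (key _ h1)] at hz
  rw [integral_gaussianReal_eq_integral_smul one_ne_zero,
    integral_gaussianReal_eq_integral_smul one_ne_zero]
  simp only [smul_eq_mul]
  linarith

open ProbabilityTheory Polynomial in
lemma integral_hermite_mul_gaussianReal {h : ℕ → ℝ → ℝ}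
    (hd : ∀ n x, HasDerivAt (h n) (h (n + 1) x) x)
    (hi : ∀ n (P : Polynomial ℝ), Integrable (fun z => P.eval z * h n z) (gaussianReal 0 1))
    (n k : ℕ) :
    ∫ z, aeval z (hermite n) * h k z ∂(gaussianReal 0 1) = ∫ z, h (n + k) z ∂(gaussianReal 0 1) := by
  have hev : ∀ (Q : Polynomial ℤ) (z : ℝ), aeval z Q = (Q.map (Int.castRingHom ℝ)).eval z := by
    intro Q z
    rw [Polynomial.eval_map, Polynomial.aeval_def]
    rfl
  have hiZ : ∀ n (Q : Polynomial ℤ),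
      Integrable (fun z => aeval z Q * h n z) (gaussianReal 0 1) := by
    intro n Q
    simp only [hev]
    exact hi n _
  induction n generalizing k with
  | zero => simp
  | succ n ih =>
    have hD : ∀ x : ℝ, HasDerivAt (fun z => aeval z (hermite n) * h k z)
        (aeval x (derivative (hermite n)) * h k x + aeval x (hermite n) * h (k + 1) x) x :=
      fun x => ((hermite n).hasDerivAt_aeval x).mul (hd k x)
    have hst := integral_id_mul_gaussianReal hD (hiZ k _)
      (by
        have := hiZ k (X * hermite n)
        simpa [mul_assoc] using this)
      ((hiZ k _).add (hiZ (k + 1) _))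
    rw [integral_add (hiZ k _) (hiZ (k + 1) _), ih (k + 1)] at hst
    have e1 : (fun z : ℝ => aeval z (hermite (n + 1)) * h k z) = fun z =>
        z * (aeval z (hermite n) * h k z) - aeval z (derivative (hermite n)) * h k z := by
      funext z
      rw [hermite_succ]
      simp
      ring
    rw [e1, integral_sub _ (hiZ k _), hst]
    · rw [add_sub_cancel_left]
      congr 2
      ring_nf
    · have := hiZ k (X * hermite n)
      simpa [mul_assoc] using this

open ProbabilityTheory Polynomial in
lemma integral_hermite_sq_gaussianReal (n : ℕ) :
    ∫ z, (aeval z (hermite n) : ℝ) ^ 2 ∂(gaussianReal 0 1) = (n.factorial : ℝ) := by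
  have h := integral_hermite_mul_gaussianReal
    (h := fun k z => aeval z (derivative^[k] (hermite n)))
    (fun k x => by
      simpa only [Function.iterate_succ', Function.comp] using
        (derivative^[k] (hermite n)).hasDerivAt_aeval x)
    (fun k P => by
      have := integrable_eval_gaussianReal
        (P * (derivative^[k] (hermite n)).map (Int.castRingHom ℝ))
      refine this.congr (ae_of_all _ fun z => ?_)
      simp only [Polynomial.eval_mul, Polynomial.eval_map, Polynomial.aeval_def]
      rfl) n 0
  have hc : derivative^[n] (hermite n) = C (n.factorial : ℤ) := by
    ext m
    rw [coeff_iterate_derivative]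
    rcases Nat.eq_zero_or_pos m with rfl | hm
    · simp [coeff_hermite_self, Nat.descFactorial_self]
    · rw [coeff_hermite_of_lt (by omega), coeff_C_of_ne_zero (by omega)]
      simp
  simp only [add_zero, hc, Function.iterate_zero, id] at h
  simp only [sq, h]
  simp

open ProbabilityTheory Polynomial in
lemma integral_abs_hermite_gaussianReal_le (n : ℕ) :
    ∫ z, |(aeval z (hermite n) : ℝ)| ∂(gaussianReal 0 1) ≤ √(n.factorial : ℝ) := by
  have hi : ∀ Q : Polynomial ℤ, Integrable (fun z : ℝ => (aeval z Q : ℝ)) (gaussianReal 0 1) := by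
    intro Q
    refine (integrable_eval_gaussianReal (Q.map (Int.castRingHom ℝ))).congr
      (ae_of_all _ fun z => ?_)
    simp only [Polynomial.eval_map, Polynomial.aeval_def]
    rfl
  have hs : Integrable (fun z : ℝ => (aeval z (hermite n) : ℝ) ^ 2) (gaussianReal 0 1) := by
    exact (hi (hermite n ^ 2)).congr (ae_of_all _ fun z => map_pow (aeval z) _ _)
  set I := ∫ z, |(aeval z (hermite n) : ℝ)| ∂(gaussianReal 0 1) with hI
  refine Real.le_sqrt_of_sq_le ?_
  have h0 : 0 ≤ ∫ z, (|(aeval z (hermite n) : ℝ)| - I) ^ 2 ∂(gaussianReal 0 1) :=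
    integral_nonneg fun z => sq_nonneg _
  have e : (fun z : ℝ => (|(aeval z (hermite n) : ℝ)| - I) ^ 2) = fun z : ℝ =>
      ((aeval z (hermite n) : ℝ) ^ 2 - 2 * I * |(aeval z (hermite n) : ℝ)|) + I ^ 2 := by
    funext z
    rw [sub_sq, sq_abs]
    ring
  have ha : Integrable (fun z : ℝ => 2 * I * |(aeval z (hermite n) : ℝ)|) (gaussianReal 0 1) :=
    (hi _).abs.const_mul _
  have hsa : Integrable (fun z : ℝ => (aeval z (hermite n) : ℝ) ^ 2 -
      2 * I * |(aeval z (hermite n) : ℝ)|) (gaussianReal 0 1) := hs.sub ha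
  rw [e, integral_add hsa (integrable_const _), integral_sub hs ha, integral_const_mul, ← hI,
    integral_hermite_sq_gaussianReal] at h0
  simp at h0
  nlinarith

/-- A sequence of integrable bounded functions, each the derivative of the preceding one. -/
structure DerivChain (W : ℕ → ℝ → ℝ) : Prop where
  hasDerivAt : ∀ n x, HasDerivAt (W n) (W (n + 1) x) x
  integrable : ∀ n, Integrable (W n)
  bounded : ∀ n, ∃ B, ∀ x, |W n x| ≤ B

lemma DerivChain.continuous {W : ℕ → ℝ → ℝ} (hW : DerivChain W) (n : ℕ) : Continuous (W n) :=
  continuous_iff_continuousAt.2 fun x => (hW.hasDerivAt n x).continuousAt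

open ProbabilityTheory in
lemma DerivChain.integrable_comp_gaussian {W : ℕ → ℝ → ℝ} (hW : DerivChain W) (n : ℕ) (y s : ℝ) :
    Integrable (fun z => W n (y + s * z)) (gaussianReal 0 1) := by
  obtain ⟨B, hB⟩ := hW.bounded n
  have := hW.continuous n
  exact (integrable_const B).mono' (by fun_prop) (ae_of_all _ fun z => hB _)

open ProbabilityTheory in
lemma DerivChain.integrable_eval_mul_gaussian {W : ℕ → ℝ → ℝ} (hW : DerivChain W) (n : ℕ)
    (P : Polynomial ℝ) (y s : ℝ) :
    Integrable (fun z => P.eval z * W n (y + s * z)) (gaussianReal 0 1) := by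
  obtain ⟨B, hB⟩ := hW.bounded n
  have := hW.continuous n
  exact (integrable_eval_gaussianReal P).mul_bdd (c := B) (by fun_prop) (ae_of_all _ fun z => hB _)

open ProbabilityTheory Polynomial in
lemma DerivChain.integral_hermite_mul {W : ℕ → ℝ → ℝ} (hW : DerivChain W) (n k : ℕ) (y s : ℝ) :
    ∫ z, aeval z (hermite n) * W k (y + s * z) ∂(gaussianReal 0 1) =
      s ^ n * ∫ z, W (n + k) (y + s * z) ∂(gaussianReal 0 1) := by
  have := integral_hermite_mul_gaussianReal
    (h := fun j z => s ^ j * W (j + k) (y + s * z))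
    (fun j x => by
      have h1 : HasDerivAt (fun z => y + s * z) s x := by
        simpa using ((hasDerivAt_id x).const_mul s).const_add y
      convert! ((hW.hasDerivAt (j + k) _).comp x h1).const_mul (s ^ j) using 1
      rw [show j + 1 + k = j + k + 1 by omega]
      ring)
    (fun j P => by
      refine ((hW.integrable_eval_mul_gaussian (j + k) P y s).const_mul (s ^ j)).congr
        (ae_of_all _ fun z => ?_)
      ring) n 0
  simpa [integral_const_mul] using this

open ProbabilityTheory in
lemma DerivChain.hasDerivAt_heat {W : ℕ → ℝ → ℝ} (hW : DerivChain W) (n : ℕ) (y s : ℝ) :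
    HasDerivAt (fun s => ∫ z, W n (y + s * z) ∂(gaussianReal 0 1))
      (s * ∫ z, W (n + 2) (y + s * z) ∂(gaussianReal 0 1)) s := by
  obtain ⟨B, hB⟩ := hW.bounded (n + 1)
  have hc := hW.continuous n
  have hc1 := hW.continuous (n + 1)
  have hid : Integrable (fun z : ℝ => z) (gaussianReal 0 1) := by
    simpa using integrable_eval_gaussianReal Polynomial.X
  have h := (hasDerivAt_integral_of_dominated_loc_of_deriv_le (μ := gaussianReal 0 1)
    (F := fun s z => W n (y + s * z)) (F' := fun s z => z * W (n + 1) (y + s * z))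
    (bound := fun z => |z| * B) (x₀ := s) (s := Set.univ) Filter.univ_mem
    (Eventually.of_forall fun s => by fun_prop)
    (hW.integrable_comp_gaussian n y s) (by fun_prop)
    (ae_of_all _ fun z t _ => by
      rw [Real.norm_eq_abs, abs_mul]
      exact mul_le_mul_of_nonneg_left (hB _) (abs_nonneg _))
    (hid.abs.mul_const B)
    (ae_of_all _ fun z t _ => by
      have h1 : HasDerivAt (fun t => y + t * z) z t := by
        simpa using ((hasDerivAt_id t).mul_const z).const_add y
      convert! (hW.hasDerivAt n _).comp t h1 using 1
      ring)).2
  convert! h using 1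
  have := hW.integral_hermite_mul 1 (n + 1) y s
  simp only [Polynomial.hermite_one, Polynomial.aeval_X, pow_one] at this
  rw [this, show 1 + (n + 1) = n + 2 by omega]

open ProbabilityTheory in
/-- The truncated inverse heat series applied to the heat evolution at time `s² / 2`. -/
noncomputable def heatSeries (W : ℕ → ℝ → ℝ) (N : ℕ) (y s : ℝ) : ℝ :=
  ∑ k ∈ Finset.range (N + 1), ((-1 : ℝ) ^ k * s ^ (2 * k) / (2 ^ k * (k.factorial : ℝ))) *
    ∫ z, W (2 * k) (y + s * z) ∂(gaussianReal 0 1)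

open ProbabilityTheory in
lemma DerivChain.hasDerivAt_heatSeries {W : ℕ → ℝ → ℝ} (hW : DerivChain W) (N : ℕ) (y s : ℝ) :
    HasDerivAt (heatSeries W N y)
      ((-1 : ℝ) ^ N * s ^ (2 * N + 1) / (2 ^ N * (N.factorial : ℝ)) *
        ∫ z, W (2 * N + 2) (y + s * z) ∂(gaussianReal 0 1)) s := by
  induction N with
  | zero =>
    have := hW.hasDerivAt_heat 0 y s
    convert! this using 1
    · funext s
      simp [heatSeries]
    · simp
  | succ N ih =>
    have hp : HasDerivAt (fun s : ℝ =>
        (-1 : ℝ) ^ (N + 1) * s ^ (2 * (N + 1)) / (2 ^ (N + 1) * ((N + 1).factorial : ℝ)))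
        ((-1 : ℝ) ^ (N + 1) * ((2 * (N + 1) : ℕ) * s ^ (2 * N + 1)) /
          (2 ^ (N + 1) * ((N + 1).factorial : ℝ))) s :=
      ((hasDerivAt_pow (2 * (N + 1)) s).const_mul _).div_const _
    have h := ih.add (hp.mul (hW.hasDerivAt_heat (2 * (N + 1)) y s))
    convert! h using 1
    · funext s
      simp only [heatSeries, Pi.add_apply, Pi.mul_apply]
      rw [Finset.sum_range_succ]
    · rw [show 2 * (N + 1) = 2 * N + 2 by ring]
      have : ((N.factorial : ℕ) : ℝ) ≠ 0 := by positivity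
      rw [Nat.factorial_succ]
      push_cast
      field_simp
      ring

open ProbabilityTheory Polynomial in
lemma DerivChain.heatSeries_sub {W : ℕ → ℝ → ℝ} (hW : DerivChain W) {N m j : ℕ} (hm : 1 ≤ m)
    (hj : j + m = N + 1) (y σ : ℝ) :
    heatSeries W N y σ - W 0 y =
      ∫ s in (0 : ℝ)..σ, (-1 : ℝ) ^ N / (2 ^ N * (N.factorial : ℝ)) * (s ^ (2 * m - 1) *
        ∫ z, aeval z (hermite (2 * j)) * W (2 * m) (y + s * z) ∂(gaussianReal 0 1)) := by
  have h0 : heatSeries W N y 0 = W 0 y := by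
    rw [heatSeries, Finset.sum_range_succ']
    simp
  have hcont : Continuous fun s => (-1 : ℝ) ^ N * s ^ (2 * N + 1) / (2 ^ N * (N.factorial : ℝ)) *
        ∫ z, W (2 * N + 2) (y + s * z) ∂(gaussianReal 0 1) := by
    have : Continuous fun s => ∫ z, W (2 * N + 2) (y + s * z) ∂(gaussianReal 0 1) :=
      continuous_iff_continuousAt.2 fun s => (hW.hasDerivAt_heat _ y s).continuousAt
    fun_prop
  rw [← h0, ← intervalIntegral.integral_eq_sub_of_hasDerivAt
    (fun s _ => hW.hasDerivAt_heatSeries N y s) (hcont.intervalIntegrable _ _)]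
  congr 1
  funext s
  rw [hW.integral_hermite_mul, show 2 * N + 2 = 2 * j + 2 * m by omega,
    show 2 * N + 1 = 2 * m - 1 + 2 * j by omega, pow_add s]
  ring

open ProbabilityTheory Polynomial ENNReal in
lemma DerivChain.lintegral_heatSeries_sub_le {W : ℕ → ℝ → ℝ} (hW : DerivChain W) {N m j : ℕ}
    (hm : 1 ≤ m) (hj : j + m = N + 1) {σ : ℝ} (hσ : 0 < σ) :
    ∫⁻ y, ‖heatSeries W N y σ - W 0 y‖ₑ ≤
      ENNReal.ofReal (σ ^ (2 * m) / (2 * m) * (√((2 * j).factorial : ℝ) /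
        (2 ^ N * (N.factorial : ℝ)))) * ∫⁻ y, ‖W (2 * m) y‖ₑ := by
  set c : ℝ := (2 ^ N * (N.factorial : ℝ))⁻¹ with hc
  have hc0 : 0 ≤ c := by positivity
  set H : ℝ → ℝ := fun z => aeval z (hermite (2 * j)) with hH
  have hHc : Continuous H := (hermite (2 * j)).continuous_aeval
  have hWc := hW.continuous (2 * m)
  have hHi : Integrable H (gaussianReal 0 1) := by
    refine (integrable_eval_gaussianReal ((hermite (2 * j)).map (Int.castRingHom ℝ))).congr
      (ae_of_all _ fun z => ?_)
    simp only [hH, Polynomial.eval_map, Polynomial.aeval_def]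
    rfl
  set I := ∫⁻ y, ‖W (2 * m) y‖ₑ with hI
  have hpt : ∀ y, ‖heatSeries W N y σ - W 0 y‖ₑ ≤ ∫⁻ s in Set.Ioc 0 σ,
      ENNReal.ofReal (c * s ^ (2 * m - 1)) *
        ∫⁻ z, ‖H z‖ₑ * ‖W (2 * m) (y + s * z)‖ₑ ∂(gaussianReal 0 1) := by
    intro y
    rw [hW.heatSeries_sub hm hj, intervalIntegral.integral_of_le hσ.le]
    refine (enorm_integral_le_lintegral_enorm _).trans ?_
    refine setLIntegral_mono' measurableSet_Ioc fun s hs => ?_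
    rw [← mul_assoc, enorm_mul]
    gcongr
    · rw [Real.enorm_eq_ofReal_abs]
      apply ENNReal.ofReal_le_ofReal
      rw [abs_mul, abs_div, abs_pow, abs_neg, abs_one, one_pow, one_div,
        abs_of_pos (by positivity : (0 : ℝ) < 2 ^ N * (N.factorial : ℝ)), abs_pow,
        abs_of_pos hs.1]
    · refine (enorm_integral_le_lintegral_enorm _).trans ?_
      simp only [enorm_mul]
      rfl
  calc ∫⁻ y, ‖heatSeries W N y σ - W 0 y‖ₑ
      ≤ ∫⁻ y, ∫⁻ s in Set.Ioc 0 σ, ENNReal.ofReal (c * s ^ (2 * m - 1)) *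
        ∫⁻ z, ‖H z‖ₑ * ‖W (2 * m) (y + s * z)‖ₑ ∂(gaussianReal 0 1) := lintegral_mono hpt
    _ = ∫⁻ s in Set.Ioc 0 σ, ∫⁻ y, ENNReal.ofReal (c * s ^ (2 * m - 1)) *
        ∫⁻ z, ‖H z‖ₑ * ‖W (2 * m) (y + s * z)‖ₑ ∂(gaussianReal 0 1) := by
      refine lintegral_lintegral_swap ?_
      refine Measurable.aemeasurable ?_
      simp only [Function.uncurry_def]
      refine Measurable.mul (by fun_prop) ?_
      refine Measurable.lintegral_prod_right'
        (f := fun q : (ℝ × ℝ) × ℝ => ‖H q.2‖ₑ * ‖W (2 * m) (q.1.1 + q.1.2 * q.2)‖ₑ) ?_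
      fun_prop
    _ = ∫⁻ s in Set.Ioc 0 σ, ENNReal.ofReal (c * s ^ (2 * m - 1)) *
        ((∫⁻ z, ‖H z‖ₑ ∂(gaussianReal 0 1)) * I) := by
      refine lintegral_congr fun s => ?_
      rw [lintegral_const_mul]
      · congr 1
        rw [lintegral_lintegral_swap]
        · rw [← lintegral_mul_const _ (by fun_prop)]
          refine lintegral_congr fun z => ?_
          rw [lintegral_const_mul' _ _ enorm_ne_top]
          congr 1
          exact lintegral_add_right_eq_self (fun y => ‖W (2 * m) y‖ₑ) (s * z)
        · refine Measurable.aemeasurable ?_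
          simp only [Function.uncurry_def]
          fun_prop
      · refine Measurable.lintegral_prod_right'
          (f := fun q : ℝ × ℝ => ‖H q.2‖ₑ * ‖W (2 * m) (q.1 + s * q.2)‖ₑ) ?_
        fun_prop
    _ = ENNReal.ofReal (c * (σ ^ (2 * m) / (2 * m))) *
        ((∫⁻ z, ‖H z‖ₑ ∂(gaussianReal 0 1)) * I) := by
      rw [lintegral_mul_const _ (by fun_prop)]
      congr 1
      rw [← ofReal_integral_eq_lintegral_ofReal]
      · congr 1
        rw [← intervalIntegral.integral_of_le hσ.le, intervalIntegral.integral_const_mul,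
          integral_pow]
        rw [show 2 * m - 1 + 1 = 2 * m by omega]
        have : (((2 * m - 1 : ℕ) : ℝ) + 1) = 2 * m := by
          rw [← Nat.cast_add_one, show 2 * m - 1 + 1 = 2 * m by omega]
          push_cast
          ring
        rw [this, zero_pow (by omega), sub_zero]
      · exact (Continuous.integrableOn_Icc (by fun_prop)).mono_set Set.Ioc_subset_Icc_self
      · refine (ae_restrict_mem measurableSet_Ioc).mono fun s hs => ?_
        have := hs.1
        simp only [Pi.zero_apply]
        positivity
    _ ≤ ENNReal.ofReal (c * (σ ^ (2 * m) / (2 * m))) *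
        (ENNReal.ofReal √((2 * j).factorial : ℝ) * I) := by
      gcongr
      have : ∫⁻ z, ‖H z‖ₑ ∂(gaussianReal 0 1) =
          ENNReal.ofReal (∫ z, |H z| ∂(gaussianReal 0 1)) :=
        (ofReal_integral_norm_eq_lintegral_enorm hHi).symm
      rw [this]
      exact ENNReal.ofReal_le_ofReal (integral_abs_hermite_gaussianReal_le _)
    _ = _ := by
      rw [← mul_assoc, ← ENNReal.ofReal_mul (by positivity)]
      congr 2
      rw [hc]
      ring

open ProbabilityTheory in
lemma DerivChain.continuous_heatSeries {W : ℕ → ℝ → ℝ} (hW : DerivChain W) (N : ℕ) (σ : ℝ) :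
    Continuous fun y => heatSeries W N y σ := by
  unfold heatSeries
  refine continuous_finsetSum _ fun k _ => Continuous.mul continuous_const ?_
  obtain ⟨B, hB⟩ := hW.bounded (2 * k)
  have hc := hW.continuous (2 * k)
  exact continuous_of_dominated (bound := fun _ => B) (fun y => by fun_prop)
    (fun y => ae_of_all _ fun z => hB _) (integrable_const B) (ae_of_all _ fun z => by fun_prop)

lemma DerivChain.integral_abs_heatSeries_sub_le {W : ℕ → ℝ → ℝ} (hW : DerivChain W) {N m j : ℕ}
    (hm : 1 ≤ m) (hj : j + m = N + 1) {σ : ℝ} (hσ : 0 < σ) :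
    Integrable (fun y => heatSeries W N y σ - W 0 y) ∧
    ∫ y, |heatSeries W N y σ - W 0 y| ≤
      σ ^ (2 * m) / (2 * m) * (√((2 * j).factorial : ℝ) / (2 ^ N * (N.factorial : ℝ))) *
        ∫ y, |W (2 * m) y| := by
  have h := hW.lintegral_heatSeries_sub_le hm hj hσ
  have hI := hW.integrable (2 * m)
  rw [← ofReal_integral_norm_eq_lintegral_enorm hI, ← ENNReal.ofReal_mul (by positivity)] at h
  have hmeas : AEStronglyMeasurable (fun y => heatSeries W N y σ - W 0 y) volume :=
    ((hW.continuous_heatSeries N σ).sub (hW.continuous 0)).aestronglyMeasurable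
  have hint : Integrable (fun y => heatSeries W N y σ - W 0 y) :=
    ⟨hmeas, lt_of_le_of_lt h ENNReal.ofReal_lt_top⟩
  refine ⟨hint, ?_⟩
  rw [← ofReal_integral_norm_eq_lintegral_enorm hint] at h
  exact (ENNReal.ofReal_le_ofReal_iff
    (mul_nonneg (by positivity) (integral_nonneg fun _ => norm_nonneg _))).1 h

lemma derivSum_eq_sum_range (ψ : ℝ → ℝ) (n : ℕ) (c t : ℝ) :
    derivSum ψ n c t = ∑ i ∈ Finset.range n,
      |iteratedDeriv (i + 1) ψ t| / (c ^ (i + 1) * ((i + 1).factorial : ℝ)) := by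
  rw [derivSum, ← Finset.Ico_add_one_right_eq_Icc, Finset.range_eq_Ico, Finset.sum_Ico_add'
    (fun i => |iteratedDeriv i ψ t| / (c ^ i * (i.factorial : ℝ)))]

lemma derivSum_nonneg (ψ : ℝ → ℝ) (n : ℕ) {c : ℝ} (hc : 0 < c) (t : ℝ) : 0 ≤ derivSum ψ n c t :=
  Finset.sum_nonneg fun _ _ => by positivity

lemma continuous_derivSum {ψ : ℝ → ℝ} (hψ : ContDiff ℝ (⊤ : ℕ∞) ψ) (n : ℕ) (c : ℝ) :
    Continuous (derivSum ψ n c) := by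
  unfold derivSum
  refine continuous_finsetSum _ fun j _ => ?_
  have := hψ.continuous_iteratedDeriv j (by exact_mod_cast le_top)
  fun_prop

lemma derivSum_le_mul (ψ : ℝ → ℝ) (n : ℕ) {c d : ℝ} (hc : 0 < c) (hd : 0 < d) (t : ℝ) :
    derivSum ψ n d t ≤ (max 1 (c / d)) ^ n * derivSum ψ n c t := by
  unfold derivSum
  rw [Finset.mul_sum]
  refine Finset.sum_le_sum fun j hj => ?_
  have h1 : c ^ j / d ^ j ≤ (max 1 (c / d)) ^ n := by
    rw [← div_pow]
    calc (c / d) ^ j ≤ (max 1 (c / d)) ^ j := by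
          gcongr
          exact le_max_right _ _
      _ ≤ _ := pow_le_pow_right₀ (le_max_left _ _) (Finset.mem_Icc.1 hj).2
  calc |iteratedDeriv j ψ t| / (d ^ j * (j.factorial : ℝ))
      = c ^ j / d ^ j * (|iteratedDeriv j ψ t| / (c ^ j * (j.factorial : ℝ))) := by
        field_simp
    _ ≤ _ := by gcongr

lemma iteratedDeriv_succ_exp_neg {ψ : ℝ → ℝ} (hψ : ContDiff ℝ (⊤ : ℕ∞) ψ) (n : ℕ) (t : ℝ) :
    iteratedDeriv (n + 1) (fun t => Real.exp (-ψ t)) t = ∑ i ∈ Finset.range (n + 1),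
      (n.choose i : ℝ) * (-iteratedDeriv (i + 1) ψ t) *
        iteratedDeriv (n - i) (fun t => Real.exp (-ψ t)) t := by
  have hd : deriv (fun t => Real.exp (-ψ t)) = fun t => (-deriv ψ t) * Real.exp (-ψ t) := by
    funext t
    have hdt : DifferentiableAt ℝ ψ t := hψ.differentiable (by simp) t
    exact (hdt.hasDerivAt.fun_neg.exp).deriv.trans (mul_comm _ _)
  have hψ' : ContDiff ℝ (⊤ : ℕ∞) (deriv ψ) := (contDiff_infty_iff_deriv.1 hψ).2
  have hn : ∀ m : ℕ, ((m : ℕ∞) : WithTop ℕ∞) ≤ ((⊤ : ℕ∞) : WithTop ℕ∞) := fun m => by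
    exact_mod_cast le_top
  rw [iteratedDeriv_succ', hd, iteratedDeriv_fun_mul]
  · refine Finset.sum_congr rfl fun i _ => ?_
    rw [iteratedDeriv_fun_neg, ← iteratedDeriv_succ']
  · exact (hψ'.neg.of_le (hn n)).contDiffAt
  · exact ((hψ.neg.exp).of_le (hn n)).contDiffAt

lemma abs_iteratedDeriv_succ_exp_neg_le_aux {ψ : ℝ → ℝ} (hψ : ContDiff ℝ (⊤ : ℕ∞) ψ) {c : ℝ}
    (hc : 0 < c) {M n : ℕ} (hn : n + 1 ≤ M) (t : ℝ)
    (ih : ∀ m ≤ n, |iteratedDeriv m (fun t => Real.exp (-ψ t)) t| ≤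
      m.factorial * c ^ m * Real.exp (-ψ t) * (max 1 (derivSum ψ M c t)) ^ m) :
    |iteratedDeriv (n + 1) (fun t => Real.exp (-ψ t)) t| ≤ (n + 1).factorial * c ^ (n + 1) *
      Real.exp (-ψ t) * (derivSum ψ M c t * (max 1 (derivSum ψ M c t)) ^ n) := by
  set D := derivSum ψ M c t with hD
  set E := max 1 D with hE
  have hE1 : 1 ≤ E := le_max_left _ _
  rw [iteratedDeriv_succ_exp_neg hψ]
  have hterm : ∀ i ∈ Finset.range (n + 1), |(n.choose i : ℝ) * (-iteratedDeriv (i + 1) ψ t) *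
        iteratedDeriv (n - i) (fun t => Real.exp (-ψ t)) t| ≤
      (n + 1).factorial * c ^ (n + 1) * Real.exp (-ψ t) * E ^ n *
        (|iteratedDeriv (i + 1) ψ t| / (c ^ (i + 1) * ((i + 1).factorial : ℝ))) := by
    intro i hi
    have hi' : i ≤ n := Nat.lt_succ_iff.1 (Finset.mem_range.1 hi)
    rw [abs_mul, abs_mul, abs_neg, abs_of_nonneg (by positivity : (0 : ℝ) ≤ n.choose i)]
    have h1 := ih (n - i) (Nat.sub_le _ _)
    have h2 : E ^ (n - i) ≤ E ^ n := pow_le_pow_right₀ hE1 (Nat.sub_le _ _)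
    have h3 : (n.choose i : ℝ) * (n - i).factorial * (i + 1).factorial ≤ (n + 1).factorial := by
      have h4 := Nat.choose_mul_factorial_mul_factorial hi'
      have : n.choose i * (n - i).factorial * (i + 1).factorial ≤ (n + 1).factorial := by
        rw [Nat.factorial_succ i, Nat.factorial_succ n]
        calc n.choose i * (n - i).factorial * ((i + 1) * i.factorial)
            = (i + 1) * (n.choose i * i.factorial * (n - i).factorial) := by ring
          _ ≤ _ := by
            rw [h4]
            gcongr
      exact_mod_cast this
    calc (n.choose i : ℝ) * |iteratedDeriv (i + 1) ψ t| *
          |iteratedDeriv (n - i) (fun t => Real.exp (-ψ t)) t|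
        ≤ (n.choose i : ℝ) * |iteratedDeriv (i + 1) ψ t| *
          ((n - i).factorial * c ^ (n - i) * Real.exp (-ψ t) * E ^ n) := by
          refine mul_le_mul_of_nonneg_left (h1.trans ?_) (by positivity)
          gcongr
      _ = ((n.choose i : ℝ) * (n - i).factorial * (i + 1).factorial) *
          (c ^ (n + 1) * Real.exp (-ψ t) * E ^ n *
          (|iteratedDeriv (i + 1) ψ t| / (c ^ (i + 1) * ((i + 1).factorial : ℝ)))) := by
          rw [show c ^ (n + 1) = c ^ (n - i) * c ^ (i + 1) by
            rw [← pow_add]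
            congr 1
            omega]
          field_simp
      _ ≤ (n + 1).factorial * (c ^ (n + 1) * Real.exp (-ψ t) * E ^ n *
          (|iteratedDeriv (i + 1) ψ t| / (c ^ (i + 1) * ((i + 1).factorial : ℝ)))) := by
          gcongr
      _ = _ := by ring
  refine (Finset.abs_sum_le_sum_abs _ _).trans ((Finset.sum_le_sum hterm).trans ?_)
  rw [← Finset.mul_sum]
  have hsum : ∑ i ∈ Finset.range (n + 1),
      |iteratedDeriv (i + 1) ψ t| / (c ^ (i + 1) * ((i + 1).factorial : ℝ)) ≤ D := by
    rw [hD, derivSum_eq_sum_range]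
    refine Finset.sum_le_sum_of_subset_of_nonneg (Finset.range_mono hn) fun _ _ _ => ?_
    positivity
  calc _ ≤ (n + 1).factorial * c ^ (n + 1) * Real.exp (-ψ t) * E ^ n * D := by gcongr
    _ = _ := by ring

lemma abs_iteratedDeriv_exp_neg_le {ψ : ℝ → ℝ} (hψ : ContDiff ℝ (⊤ : ℕ∞) ψ) {c : ℝ}
    (hc : 0 < c) {M n : ℕ} (hn : n ≤ M) (t : ℝ) :
    |iteratedDeriv n (fun t => Real.exp (-ψ t)) t| ≤
      n.factorial * c ^ n * Real.exp (-ψ t) * (max 1 (derivSum ψ M c t)) ^ n := by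
  induction n using Nat.strong_induction_on with
  | _ n ih =>
    rcases n with _ | n
    · simp
    · refine (abs_iteratedDeriv_succ_exp_neg_le_aux hψ hc hn t
        fun m hm => ih m (by omega) (by omega)).trans ?_
      rw [pow_succ' (max 1 _)]
      gcongr
      exact le_max_right _ _

lemma abs_iteratedDeriv_succ_exp_neg_le {ψ : ℝ → ℝ} (hψ : ContDiff ℝ (⊤ : ℕ∞) ψ) {c : ℝ}
    (hc : 0 < c) {M n : ℕ} (hn : n + 1 ≤ M) (t : ℝ) :
    |iteratedDeriv (n + 1) (fun t => Real.exp (-ψ t)) t| ≤ (n + 1).factorial * c ^ (n + 1) *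
      Real.exp (-ψ t) * (derivSum ψ M c t * (max 1 (derivSum ψ M c t)) ^ n) :=
  abs_iteratedDeriv_succ_exp_neg_le_aux hψ hc hn t
    fun _ hm => abs_iteratedDeriv_exp_neg_le hψ hc (by omega) t

lemma mul_max_one_pow_le {D : ℝ} (hD : 0 ≤ D) (n : ℕ) :
    D * (max 1 D) ^ n ≤ D ^ 1 + D ^ (n + 1) := by
  rcases le_total D 1 with h | h
  · rw [max_eq_left h]
    have : 0 ≤ D ^ (n + 1) := by positivity
    simpa using this
  · rw [max_eq_right h, ← pow_succ']
    have : 0 ≤ D ^ 1 := by positivity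
    linarith

lemma continuous_iteratedDeriv_exp_neg {ψ : ℝ → ℝ} (hψ : ContDiff ℝ (⊤ : ℕ∞) ψ) (n : ℕ) :
    Continuous (iteratedDeriv n fun t => Real.exp (-ψ t)) :=
  (hψ.neg.exp).continuous_iteratedDeriv n (by exact_mod_cast le_top)

lemma hasDerivAt_iteratedDeriv_exp_neg {ψ : ℝ → ℝ} (hψ : ContDiff ℝ (⊤ : ℕ∞) ψ) (n : ℕ) (t : ℝ) :
    HasDerivAt (iteratedDeriv n fun t => Real.exp (-ψ t))
      (iteratedDeriv (n + 1) (fun t => Real.exp (-ψ t)) t) t := by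
  rw [iteratedDeriv_succ]
  exact ((hψ.neg.exp).differentiable_iteratedDeriv n (by exact_mod_cast ENat.natCast_lt_top n)
    t).hasDerivAt

lemma Assumption2.integrable_exp_neg {ψ : ℝ → ℝ} {Cψ : ℕ} {Ct : ℝ} (h : Assumption2 ψ Cψ Ct) :
    Integrable fun t => Real.exp (-ψ t) := by
  by_contra hn
  have := h.norm_one
  rw [integral_undef hn] at this
  exact zero_ne_one this

lemma Assumption2.integrable_iteratedDeriv {ψ : ℝ → ℝ} {Cψ : ℕ} {Ct : ℝ}
    (h : Assumption2 ψ Cψ Ct) (n : ℕ) :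
    Integrable (iteratedDeriv n fun t => Real.exp (-ψ t)) ∧
      (1 ≤ n → ∫ t, |iteratedDeriv n (fun t => Real.exp (-ψ t)) t| ≤
        2 * (n.factorial * Ct ^ n * (Cψ * n).factorial)) := by
  rcases n with _ | n
  · exact ⟨by simpa using h.integrable_exp_neg, by omega⟩
  have i1 := h.moment_int (n + 1) (by omega) 1 le_rfl (by omega)
  have i2 := h.moment_int (n + 1) (by omega) (n + 1) (by omega) le_rfl
  have m1 := h.moment_le (n + 1) (by omega) 1 le_rfl (by omega)
  have m2 := h.moment_le (n + 1) (by omega) (n + 1) (by omega) le_rfl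
  have hC := h.Ct_pos
  have hb : ∀ t, |iteratedDeriv (n + 1) (fun t => Real.exp (-ψ t)) t| ≤
      (n + 1).factorial * Ct ^ (n + 1) * (Real.exp (-ψ t) * derivSum ψ (n + 1) Ct t ^ 1 +
        Real.exp (-ψ t) * derivSum ψ (n + 1) Ct t ^ (n + 1)) := by
    intro t
    refine (abs_iteratedDeriv_succ_exp_neg_le h.smooth hC le_rfl t).trans ?_
    rw [← mul_add, ← mul_assoc _ (Real.exp _) (_ + _)]
    refine mul_le_mul_of_nonneg_left ?_ (by positivity)
    exact mul_max_one_pow_le (derivSum_nonneg _ _ hC _) n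
  have i3 := (i1.add i2).const_mul ((n + 1).factorial * Ct ^ (n + 1))
  refine ⟨i3.mono' (continuous_iteratedDeriv_exp_neg h.smooth _).aestronglyMeasurable
    (ae_of_all _ hb), fun _ => ?_⟩
  refine (integral_mono_of_nonneg (ae_of_all _ fun t => abs_nonneg _) i3 (ae_of_all _ hb)).trans ?_
  rw [integral_const_mul]
  simp only [Pi.add_apply]
  rw [integral_add i1 i2]
  calc _ ≤ (n + 1).factorial * Ct ^ (n + 1) *
        (((Cψ * (n + 1)).factorial : ℝ) + (Cψ * (n + 1)).factorial) := by gcongr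
    _ = _ := by ring

lemma bounded_of_integrable_deriv {F F' : ℝ → ℝ} (hF : ∀ x, HasDerivAt F (F' x) x)
    (hi : Integrable F') : ∃ B, ∀ x, |F x| ≤ B := by
  refine ⟨|F 0| + ∫ x, |F' x|, fun x => ?_⟩
  have h := intervalIntegral.integral_eq_sub_of_hasDerivAt (a := 0) (b := x)
    (fun x _ => hF x) hi.intervalIntegrable
  have h2 : |∫ y in (0 : ℝ)..x, F' y| ≤ ∫ x, |F' x| := by
    refine (intervalIntegral.norm_integral_le_integral_norm_uIoc (f := F') (μ := volume)).trans ?_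
    exact setIntegral_le_integral hi.norm (ae_of_all _ fun _ => norm_nonneg _)
  have : F x = F 0 + (F x - F 0) := by ring
  rw [this, ← h]
  exact (abs_add_le _ _).trans (by gcongr)

/-- The derivatives of the rescaled density `(1/τ)·exp(−ψ(z/τ))`. -/
noncomputable def scaledDeriv (ψ : ℝ → ℝ) (τ : ℝ) (n : ℕ) (z : ℝ) : ℝ :=
  (1 / τ) ^ (n + 1) * iteratedDeriv n (fun t => Real.exp (-ψ t)) (z / τ)

lemma hasDerivAt_scaledDeriv {ψ : ℝ → ℝ} (hψ : ContDiff ℝ (⊤ : ℕ∞) ψ) (τ : ℝ) (n : ℕ) (z : ℝ) :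
    HasDerivAt (scaledDeriv ψ τ n) (scaledDeriv ψ τ (n + 1) z) z := by
  have h := ((hasDerivAt_iteratedDeriv_exp_neg hψ n (z / τ)).comp z
    ((hasDerivAt_id z).div_const τ)).const_mul ((1 / τ) ^ (n + 1))
  convert! h using 1
  rw [scaledDeriv]
  ring

lemma Assumption2.derivChain {ψ : ℝ → ℝ} {Cψ : ℕ} {Ct τ : ℝ} (h : Assumption2 ψ Cψ Ct)
    (hτ : 0 < τ) : DerivChain (scaledDeriv ψ τ) := by
  have hi : ∀ n, Integrable (scaledDeriv ψ τ n) := fun n =>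
    ((h.integrable_iteratedDeriv n).1.comp_div hτ.ne').const_mul _
  exact ⟨hasDerivAt_scaledDeriv h.smooth τ, hi, fun n =>
    bounded_of_integrable_deriv (hasDerivAt_scaledDeriv h.smooth τ n) (hi (n + 1))⟩

lemma Assumption2.integral_abs_scaledDeriv_le {ψ : ℝ → ℝ} {Cψ : ℕ} {Ct τ : ℝ}
    (h : Assumption2 ψ Cψ Ct) (hτ : 0 < τ) {n : ℕ} (hn : 1 ≤ n) :
    ∫ z, |scaledDeriv ψ τ n z| ≤
      (1 / τ) ^ n * (2 * (n.factorial * Ct ^ n * (Cψ * n).factorial)) := by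
  have e : (fun z => |scaledDeriv ψ τ n z|) = fun z => (1 / τ) ^ (n + 1) *
      (fun t => |iteratedDeriv n (fun t => Real.exp (-ψ t)) t|) (z / τ) := by
    funext z
    rw [scaledDeriv, abs_mul, abs_of_pos (by positivity)]
  rw [e, integral_const_mul, Measure.integral_comp_div
    (fun t => |iteratedDeriv n (fun t => Real.exp (-ψ t)) t|), abs_of_pos hτ, smul_eq_mul,
    ← mul_assoc]
  have e2 : (1 / τ) ^ (n + 1) * τ = (1 / τ) ^ n := by
    rw [pow_succ, mul_assoc, one_div_mul_cancel hτ.ne', mul_one]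
  rw [e2]
  gcongr
  exact (h.integrable_iteratedDeriv n).2 hn

lemma iteratedDeriv_locDensity {ψ : ℝ → ℝ} (hψ : ContDiff ℝ (⊤ : ℕ∞) ψ) (τ y : ℝ) (n : ℕ) :
    iteratedDeriv n (fun θ => locDensity ψ τ y θ) =
      fun x => (-1) ^ n * scaledDeriv ψ τ n (y - x) := by
  induction n with
  | zero =>
    funext x
    simp [locDensity, scaledDeriv]
  | succ n ih =>
    funext x
    rw [iteratedDeriv_succ, ih]
    have h := ((hasDerivAt_scaledDeriv hψ τ n (y - x)).comp x
      ((hasDerivAt_id x).const_sub y)).const_mul ((-1) ^ n)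
    refine h.deriv.trans ?_
    ring

/-- The signed kernel as a function of the displacement `y - x`. -/
noncomputable def signedProfile (σ τ : ℝ) (ψ : ℝ → ℝ) (N : ℕ) (z : ℝ) : ℝ :=
  ∑ k ∈ Finset.range (N + 1), ((-1 : ℝ) ^ k * σ ^ (2 * k) / (2 ^ k * (k.factorial : ℝ))) *
    scaledDeriv ψ τ (2 * k) z

lemma signedKernel_eq {ψ : ℝ → ℝ} (hψ : ContDiff ℝ (⊤ : ℕ∞) ψ) (σ τ : ℝ) (N : ℕ) (y x : ℝ) :
    signedKernel σ (locDensity ψ τ) N y x = signedProfile σ τ ψ N (y - x) := by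
  unfold signedKernel signedProfile
  refine Finset.sum_congr rfl fun k _ => ?_
  rw [iteratedDeriv_locDensity hψ]
  simp [pow_mul]

lemma measurableSet_ASet {ψ : ℝ → ℝ} (hψ : ContDiff ℝ (⊤ : ℕ∞) ψ) (n : ℕ) (c : ℝ) :
    MeasurableSet (ASet ψ n c) :=
  (isClosed_le (continuous_derivSum hψ n c) continuous_const).measurableSet

lemma add_setIntegral_le_ErrPsi (ψ : ℝ → ℝ) {n k : ℕ} {c : ℝ} (hc : 0 < c)
    (hk : k ∈ Finset.Icc 1 n) :
    (∫ t in (ASet ψ n c)ᶜ, Real.exp (-ψ t)) +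
      ∫ t in (ASet ψ n c)ᶜ, Real.exp (-ψ t) * derivSum ψ n c t ^ k ≤ ErrPsi ψ n c := by
  unfold ErrPsi
  gcongr
  set a : ℕ → ℝ := fun k => ∫ t in (ASet ψ n c)ᶜ, Real.exp (-ψ t) * derivSum ψ n c t ^ k with ha
  have ha0 : ∀ k, 0 ≤ a k := fun k => integral_nonneg fun t =>
    mul_nonneg (Real.exp_pos _).le (pow_nonneg (derivSum_nonneg ψ n hc t) _)
  have hbdd : BddAbove (Set.range fun k => ⨆ _ : k ∈ Finset.Icc 1 n, a k) := by
    refine ⟨∑ k ∈ Finset.Icc 1 n, a k, ?_⟩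
    rintro _ ⟨j, rfl⟩
    by_cases hj : j ∈ Finset.Icc 1 n
    · simp only [hj, ciSup_unique]
      exact Finset.single_le_sum (fun i _ => ha0 i) hj
    · simp only [hj, Real.iSup_of_isEmpty]
      exact Finset.sum_nonneg fun i _ => ha0 i
  refine le_ciSup_of_le hbdd k ?_
  simp [hk]

lemma Assumption2.integrable_mul_derivSum_pow {ψ : ℝ → ℝ} {Cψ : ℕ} {Ct : ℝ}
    (h : Assumption2 ψ Cψ Ct) {c : ℝ} (hc : 0 < c) {n k : ℕ} (hk : 1 ≤ k) (hkn : k ≤ n) :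
    Integrable fun t => Real.exp (-ψ t) * derivSum ψ n c t ^ k := by
  have hCt := h.Ct_pos
  have hcont := continuous_derivSum h.smooth n c
  have hψc := h.smooth.continuous
  refine ((h.moment_int n (hk.trans hkn) k hk hkn).const_mul
    (((max 1 (Ct / c)) ^ n) ^ k)).mono' (by fun_prop) (ae_of_all _ fun t => ?_)
  have h0 := derivSum_nonneg ψ n hc t
  rw [Real.norm_eq_abs, abs_of_nonneg (by positivity)]
  calc _ ≤ Real.exp (-ψ t) * ((max 1 (Ct / c)) ^ n * derivSum ψ n Ct t) ^ k := by
        gcongr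
        exact derivSum_le_mul ψ n hCt hc t
    _ = _ := by
      rw [mul_pow]
      ring

lemma kernel_coeff_le {σ τ lam : ℝ} {N k : ℕ} (hσ : 0 < σ) (hlam : 0 < lam) (hτ : 0 < τ)
    (hN : 1 ≤ N) (hk : k ≤ N) (h : 8 * (σ * lam * N) ≤ τ) :
    σ ^ (2 * k) / (2 ^ k * (k.factorial : ℝ)) * ((1 / τ) ^ (2 * k) *
      ((2 * k).factorial * lam ^ (2 * k))) ≤ (1 / 2) ^ k := by
  have hf : ((2 * k).factorial : ℝ) ≤ (2 * N) ^ k * k.factorial := by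
    have h1 : (2 * k).factorial ≤ (2 * N) ^ k * k.factorial :=
      (Nat.factorial_two_mul_le k).trans (by gcongr)
    exact_mod_cast h1
  have hN1 : (1 : ℝ) ≤ N := by exact_mod_cast hN
  have ha : σ * lam / τ * N ≤ 1 / 8 := by
    rw [div_mul_eq_mul_div, div_le_iff₀ hτ]
    linarith
  have ha0 : 0 < σ * lam / τ := by positivity
  calc σ ^ (2 * k) / (2 ^ k * (k.factorial : ℝ)) * ((1 / τ) ^ (2 * k) *
        ((2 * k).factorial * lam ^ (2 * k)))
      ≤ σ ^ (2 * k) / (2 ^ k * (k.factorial : ℝ)) * ((1 / τ) ^ (2 * k) *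
        (((2 * N) ^ k * k.factorial) * lam ^ (2 * k))) := by gcongr
    _ = ((σ * lam / τ) ^ 2 * N) ^ k := by
      have : (k.factorial : ℝ) ≠ 0 := by positivity
      have h2 : (0 : ℝ) < 2 ^ k := by positivity
      simp only [pow_mul, mul_pow, div_pow, one_pow]
      field_simp
    _ ≤ (1 / 2) ^ k := by
      gcongr
      nlinarith

lemma sum_range_half_pow_succ_le (N : ℕ) : ∑ k ∈ Finset.range N, (1 / 2 : ℝ) ^ (k + 1) ≤ 1 := by
  have : ∑ k ∈ Finset.range N, (1 / 2 : ℝ) ^ (k + 1) = 1 - (1 / 2) ^ N := by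
    induction N with
    | zero => simp
    | succ n ih =>
      rw [Finset.sum_range_succ, ih]
      ring
  rw [this]
  have : (0 : ℝ) ≤ (1 / 2) ^ N := by positivity
  linarith

lemma abs_signedProfile_sub_le {ψ : ℝ → ℝ} (hψ : ContDiff ℝ (⊤ : ℕ∞) ψ) {σ τ lam : ℝ} {N : ℕ}
    (hσ : 0 < σ) (hlam : 0 < lam) (hτ : 0 < τ) (hN : 1 ≤ N) (h : 8 * (σ * lam * N) ≤ τ) (z : ℝ) :
    |signedProfile σ τ ψ N z - 1 / τ * Real.exp (-ψ (z / τ))| ≤ 1 / τ *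
      ∑ k ∈ Finset.range N, (1 / 2) ^ (k + 1) * (Real.exp (-ψ (z / τ)) *
        (derivSum ψ (2 * N) lam (z / τ) *
          (max 1 (derivSum ψ (2 * N) lam (z / τ))) ^ (2 * k + 1))) := by
  set D := derivSum ψ (2 * N) lam (z / τ) with hD
  have hD0 : 0 ≤ D := derivSum_nonneg ψ _ hlam _
  have e : signedProfile σ τ ψ N z - 1 / τ * Real.exp (-ψ (z / τ)) =
      ∑ k ∈ Finset.range N, ((-1 : ℝ) ^ (k + 1) * σ ^ (2 * (k + 1)) /
        (2 ^ (k + 1) * ((k + 1).factorial : ℝ))) * scaledDeriv ψ τ (2 * (k + 1)) z := by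
    rw [signedProfile, Finset.sum_range_succ']
    simp [scaledDeriv]
  rw [e, Finset.mul_sum]
  refine (Finset.abs_sum_le_sum_abs _ _).trans (Finset.sum_le_sum fun k hk => ?_)
  have hk' : k + 1 ≤ N := Finset.mem_range.1 hk
  have hd := abs_iteratedDeriv_succ_exp_neg_le hψ hlam (M := 2 * N) (n := 2 * k + 1)
    (by omega) (z / τ)
  rw [show 2 * k + 1 + 1 = 2 * (k + 1) by ring, ← hD] at hd
  have hco := kernel_coeff_le hσ hlam hτ hN hk' h
  rw [abs_mul, abs_div, abs_mul, abs_pow, abs_neg, abs_one, one_pow, one_mul,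
    abs_of_pos (by positivity : 0 < σ ^ (2 * (k + 1))),
    abs_of_pos (by positivity : (0 : ℝ) < 2 ^ (k + 1) * ((k + 1).factorial : ℝ)), scaledDeriv,
    abs_mul, abs_of_pos (by positivity : 0 < (1 / τ) ^ (2 * (k + 1) + 1))]
  set E := max 1 D
  have hE : 0 < E := lt_of_lt_of_le one_pos (le_max_left _ _)
  calc _ ≤ σ ^ (2 * (k + 1)) / (2 ^ (k + 1) * ((k + 1).factorial : ℝ)) *
        ((1 / τ) ^ (2 * (k + 1) + 1) * ((2 * (k + 1)).factorial * lam ^ (2 * (k + 1)) *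
          Real.exp (-ψ (z / τ)) * (D * E ^ (2 * k + 1)))) := by gcongr
    _ = (1 / τ) * ((σ ^ (2 * (k + 1)) / (2 ^ (k + 1) * ((k + 1).factorial : ℝ)) *
        ((1 / τ) ^ (2 * (k + 1)) * ((2 * (k + 1)).factorial * lam ^ (2 * (k + 1))))) *
          (Real.exp (-ψ (z / τ)) * (D * E ^ (2 * k + 1)))) := by ring
    _ ≤ _ := by gcongr

/-- Pointwise control of the negative part of the signed kernel. -/
lemma max_neg_signedProfile_le {ψ : ℝ → ℝ} (hψ : ContDiff ℝ (⊤ : ℕ∞) ψ) {σ τ lam : ℝ} {N : ℕ}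
    (hσ : 0 < σ) (hlam : 0 < lam) (hτ : 0 < τ) (hN : 1 ≤ N) (h : 8 * (σ * lam * N) ≤ τ) (z : ℝ) :
    max (-signedProfile σ τ ψ N z) 0 ≤ 1 / τ * (ASet ψ (2 * N) lam)ᶜ.indicator
      (fun t => Real.exp (-ψ t) + ∑ k ∈ Finset.range N, (1 / 2) ^ (k + 1) *
        (Real.exp (-ψ t) * derivSum ψ (2 * N) lam t ^ (2 * (k + 1)))) (z / τ) := by
  have hmain := abs_signedProfile_sub_le hψ hσ hlam hτ hN h z
  by_cases hz : z / τ ∈ ASet ψ (2 * N) lam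
  · rw [Set.indicator_of_notMem (by simpa using hz), mul_zero]
    refine max_le ?_ le_rfl
    have hD1 : derivSum ψ (2 * N) lam (z / τ) ≤ 1 := hz
    rw [max_eq_left hD1] at hmain
    have hle : 1 / τ * ∑ k ∈ Finset.range N, (1 / 2) ^ (k + 1) * (Real.exp (-ψ (z / τ)) *
        (derivSum ψ (2 * N) lam (z / τ) * 1 ^ (2 * k + 1))) ≤
        1 / τ * Real.exp (-ψ (z / τ)) := by
      refine mul_le_mul_of_nonneg_left ?_ (by positivity)
      calc _ ≤ ∑ k ∈ Finset.range N, (1 / 2 : ℝ) ^ (k + 1) * (Real.exp (-ψ (z / τ)) * 1) := by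
            refine Finset.sum_le_sum fun k _ => ?_
            rw [one_pow, mul_one]
            gcongr
        _ ≤ _ := by
          rw [← Finset.sum_mul, mul_one]
          exact mul_le_of_le_one_left (Real.exp_pos _).le (sum_range_half_pow_succ_le N)
    have := (abs_le.1 (hmain.trans hle)).1
    linarith
  · rw [Set.indicator_of_mem (by simpa using hz)]
    have hD1 : 1 ≤ derivSum ψ (2 * N) lam (z / τ) := (not_le.1 hz).le
    rw [max_eq_right hD1] at hmain
    have hsum : ∀ k, derivSum ψ (2 * N) lam (z / τ) * derivSum ψ (2 * N) lam (z / τ) ^ (2 * k + 1)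
        = derivSum ψ (2 * N) lam (z / τ) ^ (2 * (k + 1)) := fun k => by ring
    simp only [hsum] at hmain
    have h1 := (abs_le.1 hmain).1
    have hp : 0 < 1 / τ * Real.exp (-ψ (z / τ)) := by positivity
    rw [mul_add]
    refine max_le (by linarith) ?_
    have : 0 ≤ |signedProfile σ τ ψ N z - 1 / τ * Real.exp (-ψ (z / τ))| := abs_nonneg _
    linarith

lemma Assumption2.integral_max_neg_signedProfile_le {ψ : ℝ → ℝ} {Cψ : ℕ} {Ct : ℝ}
    (hA : Assumption2 ψ Cψ Ct) {σ τ lam : ℝ} {N : ℕ} (hσ : 0 < σ) (hlam : 0 < lam) (hτ : 0 < τ)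
    (hN : 1 ≤ N) (h : 8 * (σ * lam * N) ≤ τ) :
    ∫ z, max (-signedProfile σ τ ψ N z) 0 ≤ ErrPsi ψ (2 * N) lam := by
  set S := (ASet ψ (2 * N) lam)ᶜ with hS
  have hSm : MeasurableSet S := (measurableSet_ASet hA.smooth _ _).compl
  set H : ℝ → ℝ := fun t => Real.exp (-ψ t) + ∑ k ∈ Finset.range N, (1 / 2) ^ (k + 1) *
        (Real.exp (-ψ t) * derivSum ψ (2 * N) lam t ^ (2 * (k + 1))) with hH
  have hterm : ∀ k ∈ Finset.range N, Integrable fun t => (1 / 2 : ℝ) ^ (k + 1) *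
        (Real.exp (-ψ t) * derivSum ψ (2 * N) lam t ^ (2 * (k + 1))) := fun k hk => by
    have := Finset.mem_range.1 hk
    exact (hA.integrable_mul_derivSum_pow hlam (by omega) (by omega)).const_mul _
  have hHi : Integrable H := hA.integrable_exp_neg.add (integrable_finsetSum _ hterm)
  have hHS : Integrable (S.indicator H) := hHi.indicator hSm
  have h1 : ∫ z, max (-signedProfile σ τ ψ N z) 0 ≤ ∫ z, 1 / τ * S.indicator H (z / τ) :=
    integral_mono_of_nonneg (ae_of_all _ fun z => le_max_right _ _)
      ((hHS.comp_div hτ.ne').const_mul _)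
      (ae_of_all _ fun z => max_neg_signedProfile_le hA.smooth hσ hlam hτ hN h z)
  refine h1.trans ?_
  rw [integral_const_mul, Measure.integral_comp_div, abs_of_pos hτ, smul_eq_mul, ← mul_assoc,
    one_div_mul_cancel hτ.ne', one_mul, integral_indicator hSm, hH,
    integral_add hA.integrable_exp_neg.integrableOn
      (integrable_finsetSum _ fun k hk => (hterm k hk).integrableOn),
    integral_finsetSum _ fun k hk => (hterm k hk).integrableOn]
  simp only [integral_const_mul]
  set I0 := ∫ t in S, Real.exp (-ψ t)
  have h0 : I0 ≤ ErrPsi ψ (2 * N) lam := by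
    refine le_trans ?_ (add_setIntegral_le_ErrPsi ψ hlam
      (Finset.mem_Icc.2 ⟨le_rfl, by omega⟩ : 1 ∈ Finset.Icc 1 (2 * N)))
    refine le_add_of_nonneg_right (integral_nonneg fun t => ?_)
    exact mul_nonneg (Real.exp_pos _).le (pow_nonneg (derivSum_nonneg ψ _ hlam t) _)
  calc _ ≤ I0 + ∑ k ∈ Finset.range N, (1 / 2 : ℝ) ^ (k + 1) * (ErrPsi ψ (2 * N) lam - I0) := by
        refine add_le_add_right (Finset.sum_le_sum fun k hk => ?_) _
        have := Finset.mem_range.1 hk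
        have h2 := add_setIntegral_le_ErrPsi ψ hlam
          (Finset.mem_Icc.2 ⟨by omega, by omega⟩ : 2 * (k + 1) ∈ Finset.Icc 1 (2 * N))
        refine mul_le_mul_of_nonneg_left ?_ (by positivity)
        linarith
    _ ≤ I0 + 1 * (ErrPsi ψ (2 * N) lam - I0) := by
      rw [← Finset.sum_mul]
      refine add_le_add_right (mul_le_mul_of_nonneg_right (sum_range_half_pow_succ_le N) ?_) _
      linarith
    _ = _ := by ring

open ProbabilityTheory in
/-- Averaging a displacement kernel against a probability measure. -/
lemma integrable_prod_displacement {k : ℝ → ℝ} (hc : Continuous k) (hi : Integrable k)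
    (μ : Measure ℝ) [IsProbabilityMeasure μ] :
    Integrable (fun q : ℝ × ℝ => k (q.1 - q.2)) (volume.prod μ) := by
  rw [integrable_prod_iff' (by fun_prop)]
  refine ⟨ae_of_all _ fun x => hi.comp_sub_right x, ?_⟩
  have : (fun x => ∫ y, ‖k (y - x)‖) = fun _ => ∫ y, ‖k y‖ := by
    funext x
    exact integral_sub_right_eq_self (fun y => ‖k y‖) x
  simp only [this]
  exact integrable_const _

lemma integral_integral_displacement {k : ℝ → ℝ} (hc : Continuous k) (hi : Integrable k)
    (μ : Measure ℝ) [IsProbabilityMeasure μ] :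
    ∫ y, ∫ x, k (y - x) ∂μ = ∫ z, k z := by
  rw [integral_integral_swap (integrable_prod_displacement hc hi μ)]
  have : (fun x => ∫ y, k (y - x)) = fun _ => ∫ y, k y := by
    funext x
    exact integral_sub_right_eq_self k x
  rw [this]
  simp

/-- Normalising the positive part of a signed displacement kernel costs at most twice the mass of
its negative part. -/
lemma integral_abs_normalized_sub_le {g w : ℝ → ℝ} (hc : Continuous g) (hi : Integrable g)
    (hg1 : ∫ z, g z = 1) (hb : ∃ B, ∀ z, |g z| ≤ B) (μ : Measure ℝ) [IsProbabilityMeasure μ]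
    (hw : Integrable fun y => (∫ x, g (y - x) ∂μ) - w y) :
    ∫ y, |(∫ x, max (g (y - x)) 0 / (∫ z, max (g z) 0) ∂μ) - w y| ≤
      2 * (∫ z, max (-g z) 0) + ∫ y, |(∫ x, g (y - x) ∂μ) - w y| := by
  obtain ⟨B, hB⟩ := hb
  have hcp : Continuous fun z => max (g z) 0 := by fun_prop
  have hcn : Continuous fun z => max (-g z) 0 := by fun_prop
  have hip : Integrable fun z => max (g z) 0 := hi.pos_part
  have hin : Integrable fun z => max (-g z) 0 := hi.neg_part
  set p := ∫ z, max (g z) 0 with hp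
  set q := ∫ z, max (-g z) 0 with hq
  have hdecomp : ∀ z, g z = max (g z) 0 - max (-g z) 0 := fun z => by
    rcases le_total (g z) 0 with h | h
    · rw [max_eq_right h, max_eq_left (by linarith)]
      ring
    · rw [max_eq_left h, max_eq_right (by linarith)]
      ring
  have hpq : p - q = 1 := by
    rw [hp, hq, ← integral_sub hip hin, ← hg1]
    exact integral_congr_ae (ae_of_all _ fun z => (hdecomp z).symm)
  have hq0 : 0 ≤ q := integral_nonneg fun z => le_max_right _ _
  have hp1 : 1 ≤ p := by linarith
  set R : ℝ → ℝ := fun y => ∫ x, max (g (y - x)) 0 ∂μ with hR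
  set Q : ℝ → ℝ := fun y => ∫ x, max (-g (y - x)) 0 ∂μ with hQ
  have hRi : Integrable R := (integrable_prod_displacement hcp hip μ).integral_prod_left
  have hQi : Integrable Q := (integrable_prod_displacement hcn hin μ).integral_prod_left
  have hR0 : ∀ y, 0 ≤ R y := fun y => integral_nonneg fun x => le_max_right _ _
  have hQ0 : ∀ y, 0 ≤ Q y := fun y => integral_nonneg fun x => le_max_right _ _
  have hRI : ∫ y, R y = p := integral_integral_displacement hcp hip μ
  have hQI : ∫ y, Q y = q := integral_integral_displacement hcn hin μ
  have hB0 : 0 ≤ B := (abs_nonneg _).trans (hB 0)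
  have hRQ : ∀ y, ∫ x, g (y - x) ∂μ = R y - Q y := by
    intro y
    rw [hR, hQ, ← integral_sub]
    · exact integral_congr_ae (ae_of_all _ fun x => hdecomp _)
    · refine (integrable_const B).mono' (by fun_prop) (ae_of_all _ fun x => ?_)
      rw [Real.norm_eq_abs, abs_of_nonneg (le_max_right _ _)]
      exact max_le ((le_abs_self _).trans (hB _)) hB0
    · refine (integrable_const B).mono' (by fun_prop) (ae_of_all _ fun x => ?_)
      rw [Real.norm_eq_abs, abs_of_nonneg (le_max_right _ _)]
      exact max_le ((neg_le_abs _).trans (hB _)) hB0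
  have hfac : 0 ≤ 1 - 1 / p := by
    rw [sub_nonneg, div_le_one (by linarith)]
    exact hp1
  have hpt : ∀ y, |(∫ x, max (g (y - x)) 0 / p ∂μ) - w y| ≤
      |(∫ x, g (y - x) ∂μ) - w y| + Q y + (1 - 1 / p) * R y := by
    intro y
    rw [integral_div]
    have e : (∫ x, max (g (y - x)) 0 ∂μ) / p - w y =
        ((∫ x, g (y - x) ∂μ) - w y) + Q y - (1 - 1 / p) * R y := by
      rw [hRQ]
      ring
    rw [e]
    refine (abs_sub _ _).trans ?_
    rw [abs_of_nonneg (mul_nonneg hfac (hR0 y))]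
    gcongr
    refine (abs_add_le _ _).trans ?_
    rw [abs_of_nonneg (hQ0 y)]
  refine (integral_mono_of_nonneg (ae_of_all _ fun y => abs_nonneg _)
    ((hw.abs.add hQi).add (hRi.const_mul _)) (ae_of_all _ hpt)).trans ?_
  have i1 : Integrable fun y => |(∫ x, g (y - x) ∂μ) - w y| + Q y := hw.abs.add hQi
  have i2 : Integrable fun y => (1 - 1 / p) * R y := hRi.const_mul _
  simp only [Pi.add_apply]
  rw [integral_add i1 i2, integral_add hw.abs hQi, integral_const_mul, hRI, hQI]
  have : (1 - 1 / p) * p = q := by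
    have : p ≠ 0 := by linarith
    field_simp
    linarith
  linarith

lemma DerivChain.integral_succ_eq_zero {W : ℕ → ℝ → ℝ} (hW : DerivChain W) (n : ℕ) :
    ∫ z, W (n + 1) z = 0 :=
  integral_eq_zero_of_hasDerivAt_of_integrable (hW.hasDerivAt n) (hW.integrable _) (hW.integrable n)

lemma Assumption2.integrable_signedProfile {ψ : ℝ → ℝ} {Cψ : ℕ} {Ct : ℝ}
    (h : Assumption2 ψ Cψ Ct) {σ τ : ℝ} (hτ : 0 < τ) (N : ℕ) :
    Integrable (signedProfile σ τ ψ N) :=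
  integrable_finsetSum _ fun k _ => ((h.derivChain hτ).integrable (2 * k)).const_mul _

lemma Assumption2.integral_signedProfile {ψ : ℝ → ℝ} {Cψ : ℕ} {Ct : ℝ}
    (h : Assumption2 ψ Cψ Ct) {σ τ : ℝ} (hτ : 0 < τ) (N : ℕ) :
    ∫ z, signedProfile σ τ ψ N z = 1 := by
  have hW := h.derivChain hτ
  unfold signedProfile
  rw [integral_finsetSum _ fun k _ => (hW.integrable (2 * k)).const_mul _,
    Finset.sum_range_succ', Finset.sum_eq_zero]
  · simp only [scaledDeriv, iteratedDeriv_zero, mul_zero, zero_add, pow_zero, pow_one,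
      Nat.factorial_zero, Nat.cast_one, div_one, one_mul, mul_one]
    rw [integral_const_mul, Measure.integral_comp_div (fun t => Real.exp (-ψ t)), h.norm_one,
      abs_of_pos hτ, smul_eq_mul, mul_one, one_div_mul_cancel hτ.ne']
  · intro k _
    rw [integral_const_mul, show 2 * (k + 1) = 2 * k + 1 + 1 by ring,
      hW.integral_succ_eq_zero, mul_zero]

lemma Assumption2.continuous_signedProfile {ψ : ℝ → ℝ} {Cψ : ℕ} {Ct : ℝ}
    (h : Assumption2 ψ Cψ Ct) {σ τ : ℝ} (hτ : 0 < τ) (N : ℕ) :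
    Continuous (signedProfile σ τ ψ N) :=
  continuous_finsetSum _ fun k _ => ((h.derivChain hτ).continuous (2 * k)).const_mul _

lemma Assumption2.bounded_signedProfile {ψ : ℝ → ℝ} {Cψ : ℕ} {Ct : ℝ}
    (h : Assumption2 ψ Cψ Ct) {σ τ : ℝ} (hτ : 0 < τ) (N : ℕ) :
    ∃ B, ∀ z, |signedProfile σ τ ψ N z| ≤ B := by
  choose B hB using (h.derivChain hτ).bounded
  refine ⟨∑ k ∈ Finset.range (N + 1),
    |(-1 : ℝ) ^ k * σ ^ (2 * k) / (2 ^ k * (k.factorial : ℝ))| * B (2 * k), fun z => ?_⟩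
  refine (Finset.abs_sum_le_sum_abs _ _).trans (Finset.sum_le_sum fun k _ => ?_)
  rw [abs_mul]
  exact mul_le_mul_of_nonneg_left (hB _ _) (abs_nonneg _)

open ProbabilityTheory in
/-- The Gaussian measure with density `srcDensity σ θ`. -/
noncomputable def srcMeasure (σ θ : ℝ) : Measure ℝ :=
  (gaussianReal 0 1).map fun z => θ - σ * z

open ProbabilityTheory in
instance (σ θ : ℝ) : IsProbabilityMeasure (srcMeasure σ θ) :=
  Measure.isProbabilityMeasure_map (by fun_prop)

open ProbabilityTheory in
lemma integral_srcMeasure {σ : ℝ} (hσ : 0 < σ) (θ : ℝ) (h : ℝ → ℝ) :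
    ∫ x, h x ∂(srcMeasure σ θ) = ∫ x, h x * srcDensity σ θ x := by
  have e : srcMeasure σ θ = gaussianReal θ ⟨σ ^ 2, sq_nonneg σ⟩ := by
    have h1 : (fun z : ℝ => θ - σ * z) = (fun z => θ + z) ∘ fun z => (-σ) * z := by
      funext z
      simp
      ring
    rw [srcMeasure, h1, ← Measure.map_map (by fun_prop) (by fun_prop),
      gaussianReal_map_const_mul, gaussianReal_map_const_add]
    congr 1
    · ring
    · ext
      simp
      rfl
  have hv : (⟨σ ^ 2, sq_nonneg σ⟩ : NNReal) ≠ 0 := by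
    intro h0
    have h1 : σ ^ 2 = 0 := congrArg NNReal.toReal h0
    exact hσ.ne' (by simpa using h1)
  rw [e, integral_gaussianReal_eq_integral_smul hv]
  congr 1
  funext x
  have hs : gaussianPDFReal θ ⟨σ ^ 2, sq_nonneg σ⟩ x =
      (√(2 * π * σ ^ 2))⁻¹ * Real.exp (-(x - θ) ^ 2 / (2 * σ ^ 2)) := rfl
  rw [smul_eq_mul, mul_comm, hs, srcDensity, Real.sqrt_mul (by positivity), Real.sqrt_sq hσ.le,
    one_div]

open ProbabilityTheory in
lemma Assumption2.integral_signedProfile_srcMeasure {ψ : ℝ → ℝ} {Cψ : ℕ} {Ct : ℝ}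
    (h : Assumption2 ψ Cψ Ct) {σ τ : ℝ} (hτ : 0 < τ) (N : ℕ) (θ y : ℝ) :
    ∫ x, signedProfile σ τ ψ N (y - x) ∂(srcMeasure σ θ) =
      heatSeries (scaledDeriv ψ τ) N (y - θ) σ := by
  have hc := h.continuous_signedProfile (σ := σ) hτ N
  rw [srcMeasure, integral_map (by fun_prop) (by fun_prop)]
  have : ∀ z, y - (θ - σ * z) = y - θ + σ * z := fun z => by ring
  simp only [this]
  unfold signedProfile heatSeries
  rw [integral_finsetSum _ fun k _ =>
    ((h.derivChain hτ).integrable_comp_gaussian (2 * k) (y - θ) σ).const_mul _]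
  simp only [integral_const_mul]

lemma Assumption2.half_integral_abs_le {ψ : ℝ → ℝ} {Cψ : ℕ} {Ct : ℝ}
    (h : Assumption2 ψ Cψ Ct) {σ τ lam : ℝ} {N m j : ℕ} (hσ : 0 < σ) (hlam : 0 < lam)
    (hτ : 0 < τ) (hN : 1 ≤ N) (hτN : 8 * (σ * lam * N) ≤ τ) (hm : 1 ≤ m) (hj : j + m = N + 1)
    (θ : ℝ) :
    (1 / 2) * ∫ y, |(∫ x, markovKernel σ (locDensity ψ τ) N y x * srcDensity σ θ x)
      - locDensity ψ τ y θ| ≤ ErrPsi ψ (2 * N) lam +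
      1 / 2 * (σ ^ (2 * m) / (2 * m) * (√((2 * j).factorial : ℝ) /
        (2 ^ N * (N.factorial : ℝ))) * ((1 / τ) ^ (2 * m) *
          (2 * ((2 * m).factorial * Ct ^ (2 * m) * (Cψ * (2 * m)).factorial)))) := by
  have hW := h.derivChain hτ
  have hp : ∀ x, pFun σ (locDensity ψ τ) N x = ∫ z, max (signedProfile σ τ ψ N z) 0 := by
    intro x
    unfold pFun
    simp only [signedKernel_eq h.smooth]
    exact integral_sub_right_eq_self (fun z => max (signedProfile σ τ ψ N z) 0) x
  have hker : ∀ y, ∫ x, markovKernel σ (locDensity ψ τ) N y x * srcDensity σ θ x =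
      ∫ x, max (signedProfile σ τ ψ N (y - x)) 0 / (∫ z, max (signedProfile σ τ ψ N z) 0)
        ∂(srcMeasure σ θ) := by
    intro y
    rw [integral_srcMeasure hσ]
    simp only [markovKernel, hp, signedKernel_eq h.smooth]
  have hloc : ∀ y, locDensity ψ τ y θ = scaledDeriv ψ τ 0 (y - θ) := by
    intro y
    simp [locDensity, scaledDeriv]
  obtain ⟨hint, hle⟩ := hW.integral_abs_heatSeries_sub_le hm hj hσ
  have hmain := integral_abs_normalized_sub_le (w := fun y => locDensity ψ τ y θ)
    (h.continuous_signedProfile (σ := σ) hτ N) (h.integrable_signedProfile hτ N)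
    (h.integral_signedProfile hτ N) (h.bounded_signedProfile hτ N) (srcMeasure σ θ) (by
      simp only [h.integral_signedProfile_srcMeasure hτ, hloc]
      exact hint.comp_sub_right θ)
  simp only [h.integral_signedProfile_srcMeasure hτ, hloc] at hmain
  rw [integral_sub_right_eq_self
    (fun y => |heatSeries (scaledDeriv ψ τ) N y σ - scaledDeriv ψ τ 0 y|) θ] at hmain
  simp only [hker, hloc]
  have hneg := h.integral_max_neg_signedProfile_le hσ hlam hτ hN hτN
  have hV := h.integral_abs_scaledDeriv_le hτ (n := 2 * m) (by omega)
  have hfin : ∫ y, |heatSeries (scaledDeriv ψ τ) N y σ - scaledDeriv ψ τ 0 y| ≤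
      σ ^ (2 * m) / (2 * m) * (√((2 * j).factorial : ℝ) /
        (2 ^ N * (N.factorial : ℝ))) * ((1 / τ) ^ (2 * m) *
          (2 * ((2 * m).factorial * Ct ^ (2 * m) * (Cψ * (2 * m)).factorial))) :=
    hle.trans (mul_le_mul_of_nonneg_left hV (by positivity))
  linarith

lemma sqrt_factorial_le (j : ℕ) : √((2 * j).factorial : ℝ) ≤ 2 ^ j * (j.factorial : ℝ) := by
  refine (Real.sqrt_le_left (by positivity)).2 ?_
  have h : (2 * j).factorial ≤ (2 ^ j * j.factorial) ^ 2 := by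
    have h1 := Nat.choose_mul_factorial_mul_factorial (show j ≤ 2 * j by omega)
    have h2 : (2 * j).choose j ≤ 4 ^ j := by
      rw [← Nat.centralBinom_eq_two_mul_choose]
      exact Nat.centralBinom_le_four_pow j
    rw [show 2 * j - j = j by omega] at h1
    rw [← h1]
    calc _ ≤ 4 ^ j * j.factorial * j.factorial := by gcongr
      _ = _ := by
        rw [show 4 = 2 ^ 2 by norm_num, ← pow_mul, mul_pow, ← pow_mul, mul_comm j 2]
        ring
  exact_mod_cast h

lemma factorial_ratio_le {N m j : ℕ} (hm : 1 ≤ m) (hj : j + m = N + 1) (hmN : 2 * m ≤ N + 4) :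
    (j.factorial : ℝ) * ((N : ℝ) / 2) ^ (m - 1) ≤ N.factorial := by
  have h1 := Nat.factorial_mul_descFactorial (show m - 1 ≤ N by omega)
  have h2 := Nat.pow_sub_le_descFactorial N (m - 1)
  rw [show N - (m - 1) = j by omega] at h1
  rw [show N + 1 - (m - 1) = j + 1 by omega] at h2
  have h3 : (N : ℝ) / 2 ≤ (j + 1 : ℕ) := by
    have : N ≤ 2 * (j + 1) := by omega
    have : (N : ℝ) ≤ 2 * ((j + 1 : ℕ) : ℝ) := by exact_mod_cast this
    linarith
  rw [← h1, Nat.cast_mul]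
  gcongr
  calc ((N : ℝ) / 2) ^ (m - 1) ≤ ((j + 1 : ℕ) : ℝ) ^ (m - 1) := by gcongr
    _ ≤ _ := by exact_mod_cast h2

lemma factorial_mul_factorial_le_pow (a b : ℕ) :
    (a.factorial * b.factorial : ℝ) ≤ ((a + b : ℕ) : ℝ) ^ (a + b) := by
  have h1 : a.factorial * b.factorial ≤ (a + b).factorial :=
    Nat.le_of_dvd (Nat.factorial_pos _) (Nat.factorial_mul_factorial_dvd_factorial_add a b)
  exact_mod_cast h1.trans (Nat.factorial_le_pow _)

/-- The ratio `√((2j)!) / (2^N N!)` decays like `N^{-(m-1)}` when `j + m = N + 1`. -/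
lemma sqrt_factorial_div_le {N m j : ℕ} (hN : 1 ≤ N) (hm : 1 ≤ m) (hj : j + m = N + 1)
    (hmN : 2 * m ≤ N + 4) :
    √((2 * j).factorial : ℝ) / (2 ^ N * (N.factorial : ℝ)) ≤ N * (1 / (N : ℝ)) ^ m := by
  obtain ⟨k, rfl⟩ : ∃ k, m = k + 1 := ⟨m - 1, by omega⟩
  have hN0 : (0 : ℝ) < N := by exact_mod_cast hN
  have h1 := sqrt_factorial_le j
  have h2 := factorial_ratio_le hm hj hmN
  have e1 : (N : ℝ) * (1 / N) ^ (k + 1) = 1 / (N : ℝ) ^ k := by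
    rw [one_div_pow, pow_succ]
    field_simp
  rw [e1, div_le_div_iff₀ (by positivity) (by positivity), one_mul]
  rw [Nat.add_sub_cancel, div_pow, mul_div_assoc', div_le_iff₀ (by positivity)] at h2
  calc √((2 * j).factorial : ℝ) * N ^ k ≤ 2 ^ j * (j.factorial : ℝ) * N ^ k := by gcongr
    _ = 2 ^ j * ((j.factorial : ℝ) * N ^ k) := by ring
    _ ≤ 2 ^ j * ((N.factorial : ℝ) * 2 ^ k) := by gcongr
    _ = 2 ^ N * (N.factorial : ℝ) := by
      rw [show N = j + k by omega, pow_add]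
      ring

lemma remainder_le {σ τ Ct L : ℝ} {N m j C : ℕ} (hσ : 0 < σ) (hCt : 0 < Ct) (hτ : 0 < τ)
    (h8 : 8 * (σ * Ct) ≤ τ) (hN : 1 ≤ N) (hm : 1 ≤ m) (hj : j + m = N + 1)
    (hmN : 2 * m ≤ N + 4) (hLN : L ^ (2 * (1 + C)) = 2 * (N : ℝ) + 1) :
    1 / 2 * (σ ^ (2 * m) / (2 * m) * (√((2 * j).factorial : ℝ) /
        (2 ^ N * (N.factorial : ℝ))) * ((1 / τ) ^ (2 * m) *
          (2 * ((2 * m).factorial * Ct ^ (2 * m) * (C * (2 * m)).factorial)))) ≤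
      N * (((2 * m + C * (2 * m) : ℕ) : ℝ) / L) ^ (2 * m + C * (2 * m)) := by
  set n := 2 * m + C * (2 * m) with hn
  have hN0 : (0 : ℝ) < N := by exact_mod_cast hN
  have hN1 : (1 : ℝ) ≤ N := by exact_mod_cast hN
  have hm0 : (1 : ℝ) ≤ m := by exact_mod_cast hm
  have hA : (σ * Ct / τ) ^ (2 * m) / (2 * m) ≤ (1 / 64) ^ m := by
    have h1 : σ * Ct / τ ≤ 1 / 8 := by
      rw [div_le_div_iff₀ hτ (by norm_num)]
      linarith
    calc _ ≤ (σ * Ct / τ) ^ (2 * m) := div_le_self (by positivity) (by linarith)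
      _ ≤ (1 / 8) ^ (2 * m) := by gcongr
      _ = _ := by
        rw [pow_mul]
        norm_num
  have hB := sqrt_factorial_div_le hN hm hj hmN
  have hD := factorial_mul_factorial_le_pow (2 * m) (C * (2 * m))
  rw [← hn] at hD
  have hE : (1 / 64) ^ m * (1 / (N : ℝ)) ^ m ≤ (1 / L) ^ n := by
    rw [hn, show 2 * m + C * (2 * m) = 2 * (1 + C) * m by ring, pow_mul, one_div_pow L, hLN,
      ← mul_pow]
    gcongr
    rw [div_mul_div_comm, one_mul]
    exact one_div_le_one_div_of_le (by positivity) (by linarith)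
  calc _ = (σ * Ct / τ) ^ (2 * m) / (2 * m) *
        (√((2 * j).factorial : ℝ) / (2 ^ N * (N.factorial : ℝ))) *
        ((2 * m).factorial * (C * (2 * m)).factorial) := by
        rw [div_pow (σ * Ct), mul_pow σ, one_div_pow]
        ring
    _ ≤ (1 / 64) ^ m * (N * (1 / (N : ℝ)) ^ m) * (n : ℝ) ^ n := by gcongr
    _ = N * (((1 / 64) ^ m * (1 / (N : ℝ)) ^ m) * (n : ℝ) ^ n) := by ring
    _ ≤ N * ((1 / L) ^ n * (n : ℝ) ^ n) := by gcongr
    _ = _ := by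
      rw [← mul_pow, one_div_mul_eq_div]

lemma exp_one_ge_two : (2 : ℝ) ≤ Real.exp 1 := by
  have := Real.add_one_le_exp (1 : ℝ)
  linarith

lemma pow_le_CbarPsi (C : ℕ) :
    (2 * Real.exp 1) ^ (4 * (1 + C)) * Real.exp 1 ^ (4 * (1 + C) ^ 2) ≤ CbarPsi C := by
  have h : 1 ≤ 16 * π ^ 2 := by nlinarith [Real.pi_gt_three]
  unfold CbarPsi
  rw [mul_assoc]
  exact le_mul_of_one_le_left (by positivity) h

lemma natCast_le_exp_one_pow (k : ℕ) : (k : ℝ) ≤ Real.exp 1 ^ k := by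
  rw [← Real.exp_nat_mul, mul_one]
  have := Real.add_one_le_exp (k : ℝ)
  linarith

lemma pow_le_CbarPsi_of_threshold (C : ℕ) :
    (2 * Real.exp 1 * (1 + C : ℕ)) ^ (2 * (1 + C)) ≤ CbarPsi C := by
  have he := exp_one_ge_two
  refine le_trans ?_ (pow_le_CbarPsi C)
  rw [mul_pow]
  have h1 : ((1 + C : ℕ) : ℝ) ^ (2 * (1 + C)) ≤ Real.exp 1 ^ (4 * (1 + C) ^ 2) := by
    calc _ ≤ (Real.exp 1 ^ (1 + C)) ^ (2 * (1 + C)) := by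
          gcongr
          exact natCast_le_exp_one_pow _
      _ = Real.exp 1 ^ (2 * (1 + C) ^ 2) := by
        rw [← pow_mul]
        ring_nf
      _ ≤ _ := pow_le_pow_right₀ (by linarith) (by nlinarith)
  have h2 : (2 * Real.exp 1) ^ (2 * (1 + C)) ≤ (2 * Real.exp 1) ^ (4 * (1 + C)) :=
    pow_le_pow_right₀ (by linarith) (by omega)
  gcongr

/-- Trading the polynomial factor `N` for half of the exponential decay. -/
lemma mul_pow_div_le {L : ℝ} {N n C : ℕ} (hL : 0 < L)
    (hLN : L ^ (2 * (1 + C)) = 2 * (N : ℝ) + 1) (hn : (n : ℝ) * Real.exp 1 ≤ L)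
    (hn' : L / Real.exp 1 - 2 * (1 + C : ℕ) ≤ n) :
    N * ((n : ℝ) / L) ^ n ≤ CbarPsi C * Real.exp (-((2 * Real.exp 1)⁻¹ * L)) := by
  have he := exp_one_ge_two
  have he0 : 0 < Real.exp 1 := Real.exp_pos _
  set a : ℕ := 2 * (1 + C) with ha
  have ha0 : (0 : ℝ) < a := by
    rw [ha]
    positivity
  have h1 : ((n : ℝ) / L) ^ n ≤ Real.exp (a - L / Real.exp 1) := by
    have : (n : ℝ) / L ≤ Real.exp (-1) := by
      rw [Real.exp_neg, div_le_iff₀ hL, inv_mul_eq_div, le_div_iff₀ he0]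
      exact hn
    calc _ ≤ Real.exp (-1) ^ n := by gcongr
      _ = Real.exp (-n) := by
        rw [← Real.exp_nat_mul]
        ring_nf
      _ ≤ _ := by
        refine Real.exp_le_exp.2 ?_
        rw [ha]
        push_cast at hn' ⊢
        linarith
  have h2 : (N : ℝ) ≤ (2 * Real.exp 1) ^ a * Real.exp 1 ^ (a * a) *
      Real.exp ((2 * Real.exp 1)⁻¹ * L) := by
    have hx : L ≤ 2 * Real.exp 1 * a * Real.exp (L / (2 * Real.exp 1 * a)) := by
      have := Real.add_one_le_exp (L / (2 * Real.exp 1 * a))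
      have h3 : L / (2 * Real.exp 1 * a) ≤ Real.exp (L / (2 * Real.exp 1 * a)) := by linarith
      rw [div_le_iff₀ (by positivity)] at h3
      linarith
    calc (N : ℝ) ≤ L ^ a := by
          rw [hLN]
          linarith [(Nat.cast_nonneg N : (0 : ℝ) ≤ N)]
      _ ≤ (2 * Real.exp 1 * a * Real.exp (L / (2 * Real.exp 1 * a))) ^ a := by gcongr
      _ = (2 * Real.exp 1) ^ a * (a : ℝ) ^ a * Real.exp ((2 * Real.exp 1)⁻¹ * L) := by
        rw [mul_pow, mul_pow _ (a : ℝ), ← Real.exp_nat_mul]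
        congr 2
        field_simp
      _ ≤ _ := by
        rw [pow_mul (Real.exp 1)]
        gcongr
        exact natCast_le_exp_one_pow a
  have h3 : Real.exp a ≤ (2 * Real.exp 1) ^ a := by
    have : Real.exp a = Real.exp 1 ^ a := by
      rw [← Real.exp_nat_mul, mul_one]
    rw [this]
    gcongr
    linarith
  calc _ ≤ (2 * Real.exp 1) ^ a * Real.exp 1 ^ (a * a) *
        Real.exp ((2 * Real.exp 1)⁻¹ * L) * Real.exp (a - L / Real.exp 1) := by gcongr
    _ = (2 * Real.exp 1) ^ a * Real.exp a * Real.exp 1 ^ (a * a) *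
        Real.exp (-((2 * Real.exp 1)⁻¹ * L)) := by
      have : (a : ℝ) - L / Real.exp 1 =
          a + (-((2 * Real.exp 1)⁻¹ * L) + -((2 * Real.exp 1)⁻¹ * L)) := by
        field_simp
        ring
      rw [this, Real.exp_add, Real.exp_add, Real.exp_neg]
      field_simp
    _ ≤ (2 * Real.exp 1) ^ a * (2 * Real.exp 1) ^ a * Real.exp 1 ^ (a * a) *
        Real.exp (-((2 * Real.exp 1)⁻¹ * L)) := by gcongr
    _ ≤ _ := by
      gcongr
      refine le_trans (le_of_eq ?_) (pow_le_CbarPsi C)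
      rw [← pow_add, ha]
      congr 2 <;> ring

/-- Theorem 1(a): TV-deficiency bound for the Markov kernel
mapping the Gaussian source to a general location target. -/
theorem location_markov_deficiency
    (σ τ lam : ℝ) (ψ : ℝ → ℝ) (Cψ : ℕ) (Ct : ℝ) (N : ℕ)
    (hψ : Assumption2 ψ Cψ Ct)
    (hN : CbarPsi Cψ ≤ 2 * (N:ℝ) + 1)
    (hτ : 8 * Real.exp 1 * σ * max Ct (lam * (N:ℝ)) ≤ τ)
    (hσ : 0 < σ) (hlam : 0 < lam) :
    ∀ θ : ℝ,
      (1/2) * ∫ y : ℝ,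
          |(∫ x : ℝ, markovKernel σ (locDensity ψ τ) N y x * srcDensity σ θ x)
            - locDensity ψ τ y θ|
        ≤ CbarPsi Cψ *
            Real.exp (-((2 * Real.exp 1)⁻¹ *
              (2*(N:ℝ)+1) ^ ((1:ℝ)/(2*(1+(Cψ:ℝ))))))
          + 4 * ErrPsi ψ (2*N) lam := by
  intro θ
  have he := exp_one_ge_two
  have hC1 := pow_le_CbarPsi_of_threshold Cψ
  set e := Real.exp 1 with hedef
  have hN1 : 1 ≤ N := by
    by_contra h0
    have h0 : N = 0 := by omega
    subst h0
    have h4 : (4 : ℝ) ≤ 2 * e * (1 + Cψ : ℕ) := by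
      push_cast
      nlinarith [(Nat.cast_nonneg Cψ : (0 : ℝ) ≤ Cψ)]
    have h5 : 2 * e * (1 + Cψ : ℕ) ≤ (2 * e * (1 + Cψ : ℕ)) ^ (2 * (1 + Cψ)) :=
      le_self_pow₀ (by linarith) (by omega)
    push_cast at hN h4 h5 hC1
    linarith
  have hNr : (1 : ℝ) ≤ N := by exact_mod_cast hN1
  have hCt := hψ.Ct_pos
  have hbase : ∀ c, 0 ≤ c → c ≤ max Ct (lam * N) → 8 * (σ * c) ≤ τ := by
    intro c hc0 hc
    calc 8 * (σ * c) = 8 * 1 * σ * c := by ring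
      _ ≤ 8 * e * σ * max Ct (lam * N) := by
        gcongr
        linarith
      _ ≤ τ := hτ
  have hτ1 := hbase Ct hCt.le (le_max_left _ _)
  have hτ2 := hbase (lam * N) (by positivity) (le_max_right _ _)
  have hτ0 : 0 < τ := lt_of_lt_of_le (by positivity) hτ1
  set L := (2 * (N : ℝ) + 1) ^ ((1 : ℝ) / (2 * (1 + (Cψ : ℝ)))) with hLdef
  have hL0 : 0 < L := Real.rpow_pos_of_pos (by positivity) _
  have hLN : L ^ (2 * (1 + Cψ)) = 2 * (N : ℝ) + 1 := by
    rw [hLdef, ← Real.rpow_natCast, ← Real.rpow_mul (by positivity)]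
    push_cast
    rw [one_div_mul_cancel (by positivity), Real.rpow_one]
  have hLlow : 2 * e * (1 + Cψ : ℕ) ≤ L := by
    refine le_of_pow_le_pow_left₀ (show 2 * (1 + Cψ) ≠ 0 by omega) hL0.le ?_
    rw [hLN]
    exact hC1.trans hN
  have hc1 : (1 : ℝ) ≤ (1 + Cψ : ℕ) := by exact_mod_cast Nat.le_add_right 1 Cψ
  have hL1 : 1 ≤ L := by nlinarith
  have hLup : L ≤ N + 1 := by
    have h1 : L ^ 2 ≤ 2 * (N : ℝ) + 1 := by
      rw [← hLN]
      exact pow_le_pow_right₀ hL1 (by omega)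
    nlinarith
  have hd : 0 < 2 * e * (1 + Cψ : ℕ) := by positivity
  set m := ⌊L / (2 * e * (1 + Cψ : ℕ))⌋₊ with hmdef
  have hm1 : 1 ≤ m := Nat.le_floor (by
    rw [Nat.cast_one, one_le_div hd]
    exact hLlow)
  have hmle : (m : ℝ) * (2 * e * (1 + Cψ : ℕ)) ≤ L := by
    rw [← le_div_iff₀ hd]
    exact Nat.floor_le (by positivity)
  have hmlt : L < (m + 1) * (2 * e * (1 + Cψ : ℕ)) := by
    rw [← div_lt_iff₀ hd]
    exact Nat.lt_floor_add_one _
  have h4m : 4 * m ≤ N + 1 := by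
    have h4 : (4 : ℝ) ≤ 2 * e * (1 + Cψ : ℕ) := by nlinarith
    have h5 : (m : ℝ) * 4 ≤ N + 1 := by
      calc (m : ℝ) * 4 ≤ m * (2 * e * (1 + Cψ : ℕ)) := by gcongr
        _ ≤ _ := hmle.trans hLup
    have h6 : m * 4 ≤ N + 1 := by exact_mod_cast h5
    omega
  obtain ⟨j, hj⟩ : ∃ j, j + m = N + 1 := ⟨N + 1 - m, by omega⟩
  have hmain := hψ.half_integral_abs_le hσ hlam hτ0 hN1 (by
    rw [mul_assoc σ]
    exact hτ2) hm1 hj θ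
  have hrem := remainder_le (C := Cψ) hσ hCt hτ0 hτ1 hN1 hm1 hj (by omega) hLN
  have hdecay := mul_pow_div_le (n := 2 * m + Cψ * (2 * m)) hL0 hLN
    (by
      rw [← hedef]
      push_cast at hmle ⊢
      linarith)
    (by
      rw [← hedef, sub_le_iff_le_add, div_le_iff₀ (by linarith)]
      push_cast at hmlt ⊢
      linarith)
  have hErr : 0 ≤ ErrPsi ψ (2 * N) lam := by
    refine le_trans (add_nonneg (integral_nonneg fun t => (Real.exp_pos _).le)
      (integral_nonneg fun t => ?_)) (add_setIntegral_le_ErrPsi ψ hlam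
      (Finset.mem_Icc.2 ⟨le_rfl, by omega⟩ : 1 ∈ Finset.Icc 1 (2 * N)))
    exact mul_nonneg (Real.exp_pos _).le (pow_nonneg (derivSum_nonneg ψ _ hlam t) _)
  linarith
end
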